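/- Upper bound on the mutual information of a mixture channel via the worst branch: for the channel Φ^(n)(ρ^(n)) = Σ_{i=1}^M γ_i φ_i^{⊗n}(ρ^(n)) with γ_i > 0, Σ γ_i = 1, any achievable rate R of entanglement-assisted classical communication satisfies R ≤ max_ρ min_{1≤i≤M} I(ρ; φ_i), where I(ρ; φ) = S(ρ) + S(φ(ρ)) − S((φ⊗id)(ψ_ρ)) is the quantum mutual information. -/

import Mathlib

open Matrix BigOperators
open scoped ComplexOrder

noncomputable section

variable {n m r : Type*} [Fintype n] [DecidableEq n] [Fintype m] [DecidableEq m] [Fintype r] [DecidableEq r]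

/-- A density matrix: positive semidefinite with unit trace. -/
def IsDensity (ρ : Matrix n n ℂ) : Prop := ρ.PosSemidef ∧ ρ.trace = 1

/-- Functional calculus for (Hermitian) matrices, junk value `0` otherwise. -/
noncomputable def matFun (f : ℝ → ℝ) (A : Matrix n n ℂ) : Matrix n n ℂ :=
  if h : A.IsHermitian then
    (h.eigenvectorUnitary : Matrix n n ℂ) *
      Matrix.diagonal (fun i => (f (h.eigenvalues i) : ℂ)) *
      star (h.eigenvectorUnitary : Matrix n n ℂ)
  else 0

/-- Von Neumann entropy (base 2), via eigenvalues; junk value `0` for non-Hermitian input. -/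
noncomputable def vnEntropy (A : Matrix n n ℂ) : ℝ :=
  if h : A.IsHermitian then (∑ i, Real.negMulLog (h.eigenvalues i)) / Real.log 2 else 0

/-- Quantum relative entropy `S(ρ‖σ) = Tr ρ (log ρ - log σ)` (base 2). -/
noncomputable def relEnt (ρ σ : Matrix n n ℂ) : ℝ :=
  ((ρ * matFun Real.log ρ).trace - (ρ * matFun Real.log σ).trace).re / Real.log 2

/-- The extension `φ ⊗ id` of a linear map on matrices to a bipartite system. -/
def tensorExt (φ : Matrix n n ℂ →ₗ[ℂ] Matrix m m ℂ) (M : Matrix (n × r) (n × r) ℂ) :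
    Matrix (m × r) (m × r) ℂ :=
  Matrix.of fun p q => φ (Matrix.of fun i j => M (i, p.2) (j, q.2)) p.1 q.1

/-- Completely positive trace preserving map. -/
def IsCPTP (φ : Matrix n n ℂ →ₗ[ℂ] Matrix m m ℂ) : Prop :=
  (∀ A, (φ A).trace = A.trace) ∧
    (∀ (k : ℕ) (M : Matrix (n × Fin k) (n × Fin k) ℂ), M.PosSemidef → (tensorExt φ M).PosSemidef)

/-- Partial trace over the second factor. -/
def partialTraceR (M : Matrix (n × r) (n × r) ℂ) : Matrix n n ℂ :=
  Matrix.of fun i j => ∑ k, M (i, k) (j, k)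

/-- A pure state: rank-one projection onto a unit vector. -/
def IsPureState (ψ : Matrix n n ℂ) : Prop :=
  ∃ v : n → ℂ, (∑ i, Complex.normSq (v i)) = 1 ∧ ψ = Matrix.vecMulVec v (star v)

end

/-! ### Kraus channels, mutual information, and the entanglement-assisted coding protocol -/

/-- A Kraus family: completeness relation `∑ Kₛ† Kₛ = 1`. -/
def IsKraus {dI dO S : ℕ} (K : Fin S → Matrix (Fin dO) (Fin dI) ℂ) : Prop :=
  ∑ s, (K s)ᴴ * K s = 1

/-- Action of a Kraus channel. -/
noncomputable def krausApply {dI dO S : ℕ} (K : Fin S → Matrix (Fin dO) (Fin dI) ℂ)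
    (ρ : Matrix (Fin dI) (Fin dI) ℂ) : Matrix (Fin dO) (Fin dO) ℂ :=
  ∑ s, K s * ρ * (K s)ᴴ

open Kronecker in
/-- Action of `φ ⊗ id_R` for a Kraus channel `φ`. -/
noncomputable def krausApplyExt {dI dO dR S : ℕ} (K : Fin S → Matrix (Fin dO) (Fin dI) ℂ)
    (M : Matrix (Fin dI × Fin dR) (Fin dI × Fin dR) ℂ) :
    Matrix (Fin dO × Fin dR) (Fin dO × Fin dR) ℂ :=
  ∑ s, (K s ⊗ₖ (1 : Matrix (Fin dR) (Fin dR) ℂ)) * M *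
    (K s ⊗ₖ (1 : Matrix (Fin dR) (Fin dR) ℂ))ᴴ

/-- The canonical purification of a state `ρ`, given by the vectorisation of `√ρ`. -/
noncomputable def canonPurif {d : ℕ} (ρ : Matrix (Fin d) (Fin d) ℂ) :
    Matrix (Fin d × Fin d) (Fin d × Fin d) ℂ :=
  Matrix.vecMulVec (fun p => matFun Real.sqrt ρ p.1 p.2)
    (star fun p => matFun Real.sqrt ρ p.1 p.2)

/-- Quantum mutual information `I(ρ;φ) = S(ρ) + S(φ(ρ)) - S((φ ⊗ id)ψ_ρ)`. -/
noncomputable def qmi {dI dO S : ℕ} (K : Fin S → Matrix (Fin dO) (Fin dI) ℂ)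
    (ρ : Matrix (Fin dI) (Fin dI) ℂ) : ℝ :=
  vnEntropy ρ + vnEntropy (krausApply K ρ) - vnEntropy (krausApplyExt K (canonPurif ρ))

/-- Index set for one `m`-block of Alice's and Bob's systems (channel input side). -/
abbrev BlkIn (dH dB m : ℕ) := (Fin m → Fin dH) × (Fin m → Fin dB)

/-- Index set for one `m`-block of Alice's and Bob's systems (channel output side). -/
abbrev BlkOut (dK dB m : ℕ) := (Fin m → Fin dK) × (Fin m → Fin dB)

/-- The Kraus operator of `φᵢ^{⊗ mn} ⊗ id_B^{⊗ mn}` labelled by `s`. -/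
noncomputable def bigKraus {dH dK S Mbr : ℕ} (dB m n : ℕ)
    (Kr : Fin Mbr → Fin S → Matrix (Fin dK) (Fin dH) ℂ)
    (i : Fin Mbr) (s : Fin n → Fin m → Fin S) :
    Matrix (Fin n → BlkOut dK dB m) (Fin n → BlkIn dH dB m) ℂ :=
  Matrix.of fun f g => ∏ k,
    ((∏ l, Kr i (s k l) ((f k).1 l) ((g k).1 l)) *
      (if (f k).2 = (g k).2 then (1 : ℂ) else 0))

/-- Output of the long-term memory channel `Σᵢ γᵢ φᵢ^{⊗mn} ⊗ id_B^{⊗mn}` on a codeword. -/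
noncomputable def chanOut {dH dK S Mbr : ℕ} (dB m n : ℕ)
    (Kr : Fin Mbr → Fin S → Matrix (Fin dK) (Fin dH) ℂ) (γ : Fin Mbr → ℝ)
    (ρcw : Matrix (Fin n → BlkIn dH dB m) (Fin n → BlkIn dH dB m) ℂ) :
    Matrix (Fin n → BlkOut dK dB m) (Fin n → BlkOut dK dB m) ℂ :=
  ∑ i, γ i • ∑ s : Fin n → Fin m → Fin S,
    bigKraus dB m n Kr i s * ρcw * (bigKraus dB m n Kr i s)ᴴ

/-- The codeword for message `α`: the product over the `n` blocks of the states obtained by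
applying Alice's local encoding maps to her shares of the entangled state `Ψ`. -/
noncomputable def codeword {dH dB m n Msz : ℕ}
    (E : Fin Msz → Fin n →
      (Matrix (Fin m → Fin dH) (Fin m → Fin dH) ℂ →ₗ[ℂ]
        Matrix (Fin m → Fin dH) (Fin m → Fin dH) ℂ))
    (Ψ : Matrix (BlkIn dH dB m) (BlkIn dH dB m) ℂ) (α : Fin Msz) :
    Matrix (Fin n → BlkIn dH dB m) (Fin n → BlkIn dH dB m) ℂ :=
  Matrix.of fun f g => ∏ k, tensorExt (E α k) Ψ (f k) (g k)

/-- Average probability of error of a code (messages equidistributed). -/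
noncomputable def codeError {dH dK S Mbr : ℕ} (dB m n Msz : ℕ)
    (Kr : Fin Mbr → Fin S → Matrix (Fin dK) (Fin dH) ℂ) (γ : Fin Mbr → ℝ)
    (Ψ : Matrix (BlkIn dH dB m) (BlkIn dH dB m) ℂ)
    (E : Fin Msz → Fin n →
      (Matrix (Fin m → Fin dH) (Fin m → Fin dH) ℂ →ₗ[ℂ]
        Matrix (Fin m → Fin dH) (Fin m → Fin dH) ℂ))
    (F : Fin Msz → Matrix (Fin n → BlkOut dK dB m) (Fin n → BlkOut dK dB m) ℂ) : ℝ :=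
  1 - (Msz : ℝ)⁻¹ *
    ∑ α, ((F α * chanOut dB m n Kr γ (codeword E Ψ α)).trace).re

/-- `R` is an achievable rate for `m`-block encodings using the shared entangled state `Ψ`:
there are codes of sizes `Msz n` with `R ≤ liminf (1/n) log Msz n`, CPTP encodings, and
POVM decodings whose average error probability vanishes as `n → ∞`. -/
def AchievableRate {dH dK S Mbr : ℕ} (Kr : Fin Mbr → Fin S → Matrix (Fin dK) (Fin dH) ℂ)
    (γ : Fin Mbr → ℝ) (m dB : ℕ)
    (Ψ : Matrix (BlkIn dH dB m) (BlkIn dH dB m) ℂ) (R : ℝ) : Prop :=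
  ∃ Msz : ℕ → ℕ, (∀ n, 1 ≤ Msz n) ∧
    R ≤ Filter.atTop.liminf (fun n => Real.logb 2 (Msz n) / n) ∧
    ∃ E : (n : ℕ) → Fin (Msz n) → Fin n →
        (Matrix (Fin m → Fin dH) (Fin m → Fin dH) ℂ →ₗ[ℂ]
          Matrix (Fin m → Fin dH) (Fin m → Fin dH) ℂ),
      ∃ F : (n : ℕ) → Fin (Msz n) →
          Matrix (Fin n → BlkOut dK dB m) (Fin n → BlkOut dK dB m) ℂ,
        (∀ n α k, IsCPTP (E n α k)) ∧
        (∀ n α, (F n α).PosSemidef) ∧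
        (∀ n : ℕ, ((1 : Matrix (Fin n → BlkOut dK dB m) (Fin n → BlkOut dK dB m) ℂ)
            - ∑ α, F n α).PosSemidef) ∧
        Filter.Tendsto (fun n => codeError dB m n (Msz n) Kr γ Ψ (E n) (F n))
          Filter.atTop (nhds 0)

/-- The `m`-shot entanglement-assisted classical capacity: supremum of achievable rates
over all shared entangled pure states (of arbitrary Bob dimension). -/
noncomputable def CeaM {dH dK S Mbr : ℕ}
    (Kr : Fin Mbr → Fin S → Matrix (Fin dK) (Fin dH) ℂ) (γ : Fin Mbr → ℝ) (m : ℕ) : ℝ :=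
  sSup {R : ℝ | ∃ dB : ℕ, ∃ Ψ : Matrix (BlkIn dH dB m) (BlkIn dH dB m) ℂ,
    IsPureState Ψ ∧ AchievableRate Kr γ m dB Ψ R}

/-- The full entanglement-assisted classical capacity `C_ea = limsup_m (1/m) C_ea^{(m)}`. -/
noncomputable def Cea {dH dK S Mbr : ℕ}
    (Kr : Fin Mbr → Fin S → Matrix (Fin dK) (Fin dH) ℂ) (γ : Fin Mbr → ℝ) : ℝ :=
  Filter.atTop.limsup (fun m => CeaM Kr γ m / m)

/-! ### Entropy through the characteristic polynomial -/

/-- Von Neumann entropy in nats, read off the roots of the characteristic polynomial. -/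
noncomputable def ent {ι : Type*} [Fintype ι] [DecidableEq ι] (A : Matrix ι ι ℂ) : ℝ :=
  (A.charpoly.roots.map fun z : ℂ => Real.negMulLog z.re).sum

section Entropy

variable {ι κ : Type*} [Fintype ι] [DecidableEq ι] [Fintype κ] [DecidableEq κ]

lemma vnEntropy_eq_ent {A : Matrix ι ι ℂ} (h : A.IsHermitian) :
    vnEntropy A = ent A / Real.log 2 := by
  rw [vnEntropy, dif_pos h, ent, h.roots_charpoly_eq_eigenvalues]
  simp

lemma ent_diagonal (d : ι → ℝ) :
    ent (Matrix.diagonal fun i => (d i : ℂ)) = ∑ i, Real.negMulLog (d i) := by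
  have : (Matrix.diagonal fun i => (d i : ℂ)).charpoly.roots
      = Finset.univ.val.map fun i => (d i : ℂ) := by
    rw [Matrix.charpoly_diagonal, Polynomial.roots_prod _ _
      (Finset.prod_ne_zero_iff.mpr fun i _ => Polynomial.X_sub_C_ne_zero _)]
    simp
  rw [ent, this]
  simp

lemma ent_mul_comm (Y : Matrix ι κ ℂ) (Z : Matrix κ ι ℂ) : ent (Y * Z) = ent (Z * Y) := by
  have key := congrArg (fun p : Polynomial ℂ =>
    (p.roots.map fun z : ℂ => Real.negMulLog z.re).sum) (Matrix.charpoly_mul_comm' Y Z)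
  have h : ∀ (k : ℕ) (p : Polynomial ℂ), p ≠ 0 →
      (((Polynomial.X ^ k * p).roots).map fun z : ℂ => Real.negMulLog z.re).sum
        = (p.roots.map fun z : ℂ => Real.negMulLog z.re).sum := by
    intro k p hp
    rw [Polynomial.roots_mul (mul_ne_zero (pow_ne_zero _ Polynomial.X_ne_zero) hp)]
    simp [Multiset.map_nsmul, Multiset.sum_nsmul]
  beta_reduce at key
  rw [h _ _ (Matrix.charpoly_monic _).ne_zero, h _ _ (Matrix.charpoly_monic _).ne_zero] at key
  exact key

lemma ent_transpose (A : Matrix ι ι ℂ) : ent Aᵀ = ent A := by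
  rw [ent, ent, Matrix.charpoly_transpose]

lemma ent_submatrix (A : Matrix ι ι ℂ) (e : κ ≃ ι) : ent (A.submatrix e e) = ent A := by
  have := Matrix.charpoly_reindex e.symm A
  simp only [Matrix.reindex_apply, Equiv.symm_symm] at this
  rw [ent, ent, this]

lemma ent_conj {U A : Matrix ι ι ℂ} (hU : Uᴴ * U = 1) : ent (U * A * Uᴴ) = ent A := by
  rw [ent_mul_comm, ← Matrix.mul_assoc, hU, Matrix.one_mul]

/-- Spectral decomposition of a positive semidefinite matrix. -/
lemma exists_spectral {A : Matrix ι ι ℂ} (hA : A.PosSemidef) :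
    ∃ (U : Matrix ι ι ℂ) (q : ι → ℝ), Uᴴ * U = 1 ∧ U * Uᴴ = 1 ∧ (∀ i, 0 ≤ q i) ∧
      A = U * Matrix.diagonal (fun i => (q i : ℂ)) * Uᴴ := by
  refine ⟨hA.1.eigenvectorUnitary, hA.1.eigenvalues, ?_, ?_, hA.eigenvalues_nonneg, ?_⟩
  · exact (Matrix.mem_unitaryGroup_iff'.mp hA.1.eigenvectorUnitary.2)
  · exact (Matrix.mem_unitaryGroup_iff.mp hA.1.eigenvectorUnitary.2)
  · have := hA.1.spectral_theorem
    rw [Unitary.conjStarAlgAut_apply] at this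
    exact this

lemma ent_eq_of_spectral {A U : Matrix ι ι ℂ} {q : ι → ℝ} (hU : Uᴴ * U = 1)
    (hA : A = U * Matrix.diagonal (fun i => (q i : ℂ)) * Uᴴ) :
    ent A = ∑ i, Real.negMulLog (q i) := by
  rw [hA, ent_conj hU, ent_diagonal]

/-- A positive semidefinite matrix is a Gram matrix. -/
lemma exists_gram {A : Matrix ι ι ℂ} (hA : A.PosSemidef) :
    ∃ G : Matrix ι ι ℂ, A = G * Gᴴ := by
  obtain ⟨U, q, -, -, hq, rfl⟩ := exists_spectral hA
  refine ⟨U * Matrix.diagonal (fun i => ((Real.sqrt (q i) : ℝ) : ℂ)), ?_⟩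
  rw [Matrix.conjTranspose_mul, Matrix.diagonal_conjTranspose, Matrix.mul_assoc U _ (_ * _),
    ← Matrix.mul_assoc _ _ Uᴴ, Matrix.diagonal_mul_diagonal, Matrix.mul_assoc]
  congr 3
  ext i
  simp only [Pi.star_apply, RCLike.star_def, Complex.conj_ofReal]
  rw [← Complex.ofReal_mul, Real.mul_self_sqrt (hq i)]

lemma trace_spectral {U : Matrix ι ι ℂ} {q : ι → ℝ} (hU : Uᴴ * U = 1) :
    (U * Matrix.diagonal (fun i => (q i : ℂ)) * Uᴴ).trace = ((∑ i, q i : ℝ) : ℂ) := by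
  rw [Matrix.trace_mul_comm, ← Matrix.mul_assoc, hU, Matrix.one_mul, Matrix.trace_diagonal]
  simp

lemma ent_nonneg {A : Matrix ι ι ℂ} (hA : IsDensity A) : 0 ≤ ent A := by
  obtain ⟨U, q, hU, -, hq, rfl⟩ := exists_spectral hA.1
  have ht := hA.2
  rw [trace_spectral hU] at ht
  have ht' : ∑ i, q i = 1 := by exact_mod_cast ht
  rw [ent_eq_of_spectral hU rfl]
  refine Finset.sum_nonneg fun i _ => Real.negMulLog_nonneg (hq i) ?_
  rw [← ht']
  exact Finset.single_le_sum (fun j _ => hq j) (Finset.mem_univ i)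

lemma ent_le_card {A : Matrix ι ι ℂ} (hA : A.PosSemidef) : ent A ≤ Fintype.card ι := by
  obtain ⟨U, q, hU, -, hq, rfl⟩ := exists_spectral hA
  rw [ent_eq_of_spectral hU rfl]
  calc ∑ i, Real.negMulLog (q i) ≤ ∑ _i : ι, (1 : ℝ) := by
        refine Finset.sum_le_sum fun i _ => ?_
        rcases (hq i).eq_or_lt with h | h
        · simp [← h]
        · have h1 := Real.one_sub_inv_le_log_of_pos h
          have h2 : q i * (1 - (q i)⁻¹) ≤ q i * Real.log (q i) :=
            mul_le_mul_of_nonneg_left h1 h.le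
          rw [mul_sub, mul_inv_cancel₀ h.ne'] at h2
          rw [Real.negMulLog]
          linarith
    _ = Fintype.card ι := by simp

lemma ent_of_unique [Unique ι] {A : Matrix ι ι ℂ} (hA : IsDensity A) : ent A = 0 := by
  have h1 : A = Matrix.diagonal fun _ => ((1 : ℝ) : ℂ) := by
    have := hA.2
    rw [Matrix.trace, Fintype.sum_unique] at this
    ext i j
    rw [Subsingleton.elim i default, Subsingleton.elim j default]
    simpa using this
  rw [h1, ent_diagonal]
  simp

end Entropy

/-! ### Monotonicity of the relative entropy from a variational principle -/

section Variational

variable {ι : Type*} [Fintype ι] [DecidableEq ι]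

lemma trace_conjTranspose_mul_diagonal_mul (Y : Matrix ι ι ℂ) (q : ι → ℝ) :
    (Yᴴ * Matrix.diagonal (fun i => (q i : ℂ)) * Y).trace.re
      = ∑ i, ∑ j, q i * Complex.normSq (Y i j) := by
  rw [Finset.sum_comm]
  change (∑ j, (Yᴴ * Matrix.diagonal (fun i => (q i : ℂ)) * Y) j j).re = _
  simp only [Matrix.mul_apply (N := Y), Matrix.mul_diagonal,
    Matrix.conjTranspose_apply, Complex.re_sum, RCLike.star_def]
  refine Finset.sum_congr rfl fun j _ => Finset.sum_congr rfl fun i _ => ?_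
  simp [Complex.normSq_apply]
  ring

lemma trace_mul_diagonal_mul_conjTranspose (Y : Matrix ι ι ℂ) (p : ι → ℝ) :
    (Y * Matrix.diagonal (fun i => (p i : ℂ)) * Yᴴ).trace.re
      = ∑ i, ∑ j, p j * Complex.normSq (Y i j) := by
  change (∑ j, (Y * Matrix.diagonal (fun i => (p i : ℂ)) * Yᴴ) j j).re = _
  simp only [Matrix.mul_apply (N := Yᴴ), Matrix.mul_diagonal,
    Matrix.conjTranspose_apply, Complex.re_sum, RCLike.star_def]
  refine Finset.sum_congr rfl fun j _ => Finset.sum_congr rfl fun i _ => ?_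
  simp [Complex.normSq_apply]
  ring

lemma trace_diagonal_mul_conjTranspose_mul (w Y : Matrix ι ι ℂ) (p : ι → ℝ) :
    (Matrix.diagonal (fun i => (p i : ℂ)) * wᴴ * Y).trace.re
      = ∑ i, ∑ j, p j * ((w i j).re * (Y i j).re + (w i j).im * (Y i j).im) := by
  rw [Finset.sum_comm]
  change (∑ j, (Matrix.diagonal (fun i => (p i : ℂ)) * wᴴ * Y) j j).re = _
  simp only [Matrix.mul_apply (N := Y), Matrix.diagonal_mul,
    Matrix.conjTranspose_apply, Complex.re_sum, RCLike.star_def]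
  refine Finset.sum_congr rfl fun j _ => Finset.sum_congr rfl fun i _ => ?_
  simp
  ring

/-- The quadratic functional whose supremum over `X` is a resolvent expectation. -/
noncomputable def resolventFunctional (ρ σ : Matrix ι ι ℂ) (t : ℝ) (X : Matrix ι ι ℂ) : ℝ :=
  2 * (ρ * X).trace.re - (Xᴴ * σ * X).trace.re - t * (X * ρ * Xᴴ).trace.re

/-- The resolvent expectation in terms of spectral data. -/
noncomputable def resolventVal (U V : Matrix ι ι ℂ) (p q : ι → ℝ) (t : ℝ) : ℝ :=
  ∑ i, ∑ j, Complex.normSq ((Uᴴ * V) i j) * p j * (p j / (q i + t * p j))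

lemma resolventFunctional_eq {U V ρ σ : Matrix ι ι ℂ} {p q : ι → ℝ}
    (hU : Uᴴ * U = 1) (hV : Vᴴ * V = 1)
    (hρ : ρ = V * Matrix.diagonal (fun i => (p i : ℂ)) * Vᴴ)
    (hσ : σ = U * Matrix.diagonal (fun i => (q i : ℂ)) * Uᴴ) (t : ℝ) (Y : Matrix ι ι ℂ) :
    resolventFunctional ρ σ t (U * Y * Vᴴ) = ∑ i, ∑ j,
      (2 * (p j * (((Uᴴ * V) i j).re * (Y i j).re + ((Uᴴ * V) i j).im * (Y i j).im))
        - q i * Complex.normSq (Y i j) - t * (p j * Complex.normSq (Y i j))) := by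
  have h1 : (ρ * (U * Y * Vᴴ)).trace
      = (Matrix.diagonal (fun i => (p i : ℂ)) * (Uᴴ * V)ᴴ * Y).trace := by
    rw [hρ, Matrix.trace_mul_comm, Matrix.conjTranspose_mul, Matrix.conjTranspose_conjTranspose]
    calc (U * Y * Vᴴ * (V * diagonal (fun i => (p i : ℂ)) * Vᴴ)).trace
        = (U * Y * (Vᴴ * V) * (diagonal (fun i => (p i : ℂ)) * Vᴴ)).trace := by
          simp only [Matrix.mul_assoc]
      _ = (U * Y * (diagonal (fun i => (p i : ℂ)) * Vᴴ)).trace := by rw [hV, Matrix.mul_one]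
      _ = _ := by
          rw [Matrix.trace_mul_comm]
          simp only [Matrix.mul_assoc]
  have h2 : ((U * Y * Vᴴ)ᴴ * σ * (U * Y * Vᴴ)).trace
      = (Yᴴ * Matrix.diagonal (fun i => (q i : ℂ)) * Y).trace := by
    rw [hσ]
    simp only [Matrix.conjTranspose_mul, Matrix.conjTranspose_conjTranspose]
    calc (V * (Yᴴ * Uᴴ) * (U * diagonal (fun i => (q i : ℂ)) * Uᴴ) * (U * Y * Vᴴ)).trace
        = (V * (Yᴴ * (Uᴴ * U) * diagonal (fun i => (q i : ℂ)) * (Uᴴ * U) * Y * Vᴴ)).trace := by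
          simp only [Matrix.mul_assoc]
      _ = (Yᴴ * diagonal (fun i => (q i : ℂ)) * Y * (Vᴴ * V)).trace := by
          rw [hU, Matrix.mul_one, Matrix.mul_one, Matrix.trace_mul_comm]
          simp only [Matrix.mul_assoc]
      _ = _ := by rw [hV, Matrix.mul_one]
  have h3 : ((U * Y * Vᴴ) * ρ * (U * Y * Vᴴ)ᴴ).trace
      = (Y * Matrix.diagonal (fun i => (p i : ℂ)) * Yᴴ).trace := by
    rw [hρ]
    simp only [Matrix.conjTranspose_mul, Matrix.conjTranspose_conjTranspose]
    calc (U * Y * Vᴴ * (V * diagonal (fun i => (p i : ℂ)) * Vᴴ) * (V * (Yᴴ * Uᴴ))).trace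
        = (U * (Y * (Vᴴ * V) * diagonal (fun i => (p i : ℂ)) * (Vᴴ * V) * Yᴴ * Uᴴ)).trace := by
          simp only [Matrix.mul_assoc]
      _ = (Y * diagonal (fun i => (p i : ℂ)) * Yᴴ * (Uᴴ * U)).trace := by
          rw [hV, Matrix.mul_one, Matrix.mul_one, Matrix.trace_mul_comm]
          simp only [Matrix.mul_assoc]
      _ = _ := by rw [hU, Matrix.mul_one]
  rw [resolventFunctional, h1, h2, h3, trace_diagonal_mul_conjTranspose_mul,
    trace_conjTranspose_mul_diagonal_mul, trace_mul_diagonal_mul_conjTranspose]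
  simp only [Finset.mul_sum, ← Finset.sum_sub_distrib]

lemma resolventFunctional_le {U V ρ σ : Matrix ι ι ℂ} {p q : ι → ℝ}
    (hU : Uᴴ * U = 1) (hU' : U * Uᴴ = 1) (hV : Vᴴ * V = 1) (hV' : V * Vᴴ = 1)
    (hp : ∀ i, 0 ≤ p i) (hq : ∀ i, 0 ≤ q i)
    (hρ : ρ = V * Matrix.diagonal (fun i => (p i : ℂ)) * Vᴴ)
    (hσ : σ = U * Matrix.diagonal (fun i => (q i : ℂ)) * Uᴴ) {t : ℝ} (ht : 0 < t)
    (X : Matrix ι ι ℂ) : resolventFunctional ρ σ t X ≤ resolventVal U V p q t := by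
  have hX : X = U * (Uᴴ * X * V) * Vᴴ := by
    calc X = (U * Uᴴ) * X * (V * Vᴴ) := by rw [hU', hV', Matrix.one_mul, Matrix.mul_one]
      _ = _ := by simp only [Matrix.mul_assoc]
  rw [hX, resolventFunctional_eq hU hV hρ hσ, resolventVal]
  refine Finset.sum_le_sum fun i _ => Finset.sum_le_sum fun j _ => ?_
  generalize (Uᴴ * X * V) i j = y
  generalize (Uᴴ * V) i j = w
  have hc : 0 ≤ q i + t * p j := add_nonneg (hq i) (mul_nonneg ht.le (hp j))
  simp only [Complex.normSq_apply]
  rcases hc.eq_or_lt with h | h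
  · have h1 : t * p j = 0 := by
      have := mul_nonneg ht.le (hp j)
      have := hq i
      linarith
    have h2 : q i = 0 := by linarith
    have h3 : p j = 0 := by
      rcases mul_eq_zero.mp h1 with h | h
      · exact absurd h ht.ne'
      · exact h
    simp [h2, h3]
  · rw [← mul_div_assoc, le_div_iff₀ h]
    nlinarith [sq_nonneg ((q i + t * p j) * y.re - p j * w.re),
      sq_nonneg ((q i + t * p j) * y.im - p j * w.im)]

lemma exists_resolventFunctional_eq {U V ρ σ : Matrix ι ι ℂ} {p q : ι → ℝ}
    (hU : Uᴴ * U = 1) (hV : Vᴴ * V = 1)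
    (hp : ∀ i, 0 ≤ p i) (hq : ∀ i, 0 ≤ q i)
    (hρ : ρ = V * Matrix.diagonal (fun i => (p i : ℂ)) * Vᴴ)
    (hσ : σ = U * Matrix.diagonal (fun i => (q i : ℂ)) * Uᴴ) {t : ℝ} (ht : 0 < t) :
    ∃ X, resolventFunctional ρ σ t X = resolventVal U V p q t := by
  refine ⟨U * (Matrix.of fun i j => ((p j / (q i + t * p j) : ℝ) : ℂ) * (Uᴴ * V) i j) * Vᴴ, ?_⟩
  rw [resolventFunctional_eq hU hV hρ hσ, resolventVal]
  refine Finset.sum_congr rfl fun i _ => Finset.sum_congr rfl fun j _ => ?_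
  rw [Matrix.of_apply]
  generalize (Uᴴ * V) i j = w
  have hc : 0 ≤ q i + t * p j := add_nonneg (hq i) (mul_nonneg ht.le (hp j))
  simp only [Complex.normSq_apply, Complex.re_ofReal_mul, Complex.im_ofReal_mul]
  rcases hc.eq_or_lt with h | h
  · rw [← h]
    simp
  · have hr : (q i + t * p j) * (p j / (q i + t * p j)) = p j := mul_div_cancel₀ _ h.ne'
    generalize p j / (q i + t * p j) = r at hr
    linear_combination (-(r * (w.re * w.re + w.im * w.im))) * hr

/-- A primitive in `t` of `resolventVal`. -/
noncomputable def resolventPrim (U V : Matrix ι ι ℂ) (p q : ι → ℝ) (t : ℝ) : ℝ :=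
  ∑ i, ∑ j, Complex.normSq ((Uᴴ * V) i j) * p j * Real.log (q i + t * p j)

lemma hasDerivAt_resolventPrim (U V : Matrix ι ι ℂ) {p q : ι → ℝ}
    (hp : ∀ i, 0 ≤ p i) (hq : ∀ i, 0 ≤ q i) {t : ℝ} (ht : 0 < t) :
    HasDerivAt (resolventPrim U V p q) (resolventVal U V p q t) t := by
  unfold resolventPrim resolventVal
  refine HasDerivAt.fun_sum fun i _ => HasDerivAt.fun_sum fun j _ => ?_
  rcases (hp j).eq_or_lt with h | h
  · simp only [← h, mul_zero, zero_mul]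
    exact hasDerivAt_const _ _
  · refine HasDerivAt.const_mul _ ?_
    have hpos : q i + t * p j ≠ 0 := by
      have := hq i
      have := mul_pos ht h
      linarith
    have h1 : HasDerivAt (fun t => q i + t * p j) (p j) t := by
      simpa using ((hasDerivAt_id t).mul_const (p j)).const_add (q i)
    exact h1.log hpos

/-- Relative entropy in terms of spectral data. -/
noncomputable def relEntVal (U V : Matrix ι ι ℂ) (p q : ι → ℝ) : ℝ :=
  ∑ i, ∑ j, Complex.normSq ((Uᴴ * V) i j) * p j * (Real.log (p j) - Real.log (q i))

/-- A regularisation of `relEntVal`. -/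
noncomputable def relEntReg (U V : Matrix ι ι ℂ) (p q : ι → ℝ) (δ : ℝ) : ℝ :=
  ∑ i, ∑ j, Complex.normSq ((Uᴴ * V) i j) * p j *
    (Real.log (δ * q i + p j) - Real.log (q i + δ * p j))

lemma tendsto_relEntReg (U V : Matrix ι ι ℂ) {p q : ι → ℝ}
    (hs : ∀ i j, q i = 0 → Complex.normSq ((Uᴴ * V) i j) * p j = 0) :
    Filter.Tendsto (relEntReg U V p q) (nhdsWithin 0 (Set.Ioi 0))
      (nhds (relEntVal U V p q)) := by
  unfold relEntReg relEntVal
  refine tendsto_finsetSum _ fun i _ => tendsto_finsetSum _ fun j _ => ?_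
  by_cases h0 : Complex.normSq ((Uᴴ * V) i j) * p j = 0
  · simp only [h0, zero_mul]
    exact tendsto_const_nhds
  · have hpj : p j ≠ 0 := fun h => h0 (by rw [h, mul_zero])
    have hqi : q i ≠ 0 := fun h => h0 (hs i j h)
    refine Filter.Tendsto.const_mul _ ?_
    refine Filter.Tendsto.mono_left ?_ nhdsWithin_le_nhds
    refine Filter.Tendsto.sub ?_ ?_
    · have : Filter.Tendsto (fun δ : ℝ => δ * q i + p j) (nhds 0) (nhds (p j)) := by
        have h : Continuous fun δ : ℝ => δ * q i + p j := by fun_prop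
        simpa using h.tendsto 0
      exact this.log hpj
    · have : Filter.Tendsto (fun δ : ℝ => q i + δ * p j) (nhds 0) (nhds (q i)) := by
        have h : Continuous fun δ : ℝ => q i + δ * p j := by fun_prop
        simpa using h.tendsto 0
      exact this.log hqi

lemma sum_normSq_col {w : Matrix ι ι ℂ} (hw : wᴴ * w = 1) (j : ι) :
    ∑ i, Complex.normSq (w i j) = 1 := by
  have := congrFun (congrFun hw j) j
  rw [Matrix.mul_apply, Matrix.one_apply_eq] at this
  have h2 : ((∑ i, Complex.normSq (w i j) : ℝ) : ℂ) = 1 := by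
    rw [← this]
    push_cast
    refine Finset.sum_congr rfl fun i _ => ?_
    rw [Matrix.conjTranspose_apply, RCLike.star_def, Complex.normSq_eq_conj_mul_self]
  exact_mod_cast h2

lemma unitary_mul {U V : Matrix ι ι ℂ} (hU' : U * Uᴴ = 1) (hV : Vᴴ * V = 1) :
    (Uᴴ * V)ᴴ * (Uᴴ * V) = 1 := by
  rw [Matrix.conjTranspose_mul, Matrix.conjTranspose_conjTranspose, Matrix.mul_assoc,
    ← Matrix.mul_assoc U, hU', Matrix.one_mul, hV]

lemma resolventPrim_inv_sub {U V : Matrix ι ι ℂ} {p q : ι → ℝ} (hp : ∀ i, 0 ≤ p i)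
    (hq : ∀ i, 0 ≤ q i) (hU' : U * Uᴴ = 1) (hV : Vᴴ * V = 1) {δ : ℝ} (hδ : 0 < δ) :
    resolventPrim U V p q δ⁻¹ - resolventPrim U V p q δ
      = relEntReg U V p q δ - (∑ j, p j) * Real.log δ := by
  have hw := sum_normSq_col (unitary_mul hU' hV)
  have h1 : (∑ j, p j) * Real.log δ
      = ∑ i, ∑ j, Complex.normSq ((Uᴴ * V) i j) * p j * Real.log δ := by
    rw [Finset.sum_comm, Finset.sum_mul]
    refine Finset.sum_congr rfl fun j _ => ?_
    rw [← Finset.sum_mul, ← Finset.sum_mul, hw j, one_mul]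
  rw [h1, resolventPrim, resolventPrim, relEntReg, ← Finset.sum_sub_distrib,
    ← Finset.sum_sub_distrib]
  refine Finset.sum_congr rfl fun i _ => ?_
  rw [← Finset.sum_sub_distrib, ← Finset.sum_sub_distrib]
  refine Finset.sum_congr rfl fun j _ => ?_
  rw [← mul_sub, ← mul_sub]
  rcases (hp j).eq_or_lt with h | h
  · simp [← h]
  · congr 1
    have h2 : 0 < δ * q i + p j := by
      have := mul_nonneg hδ.le (hq i)
      linarith
    have h3 : q i + δ⁻¹ * p j = (δ * q i + p j) / δ := by
      field_simp
    rw [h3, Real.log_div h2.ne' hδ.ne']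
    ring

end Variational

/-- Joint monotonicity of the relative entropy: if testing the target pair `(ρ', σ')` against `X`
is dominated by testing the pairs `(ρ a, σ a)` against `Λ a X`, then the relative
entropy decreases. -/
lemma relEntVal_le_sum {α ι κ : Type*} [Fintype α] [Fintype ι] [DecidableEq ι] [Fintype κ]
    [DecidableEq κ] {c : α → ℝ} (hc : ∀ a, 0 ≤ c a)
    {U V ρ σ : α → Matrix ι ι ℂ} {p q : α → ι → ℝ}
    (hU : ∀ a, (U a)ᴴ * U a = 1) (hU' : ∀ a, U a * (U a)ᴴ = 1)
    (hV : ∀ a, (V a)ᴴ * V a = 1) (hV' : ∀ a, V a * (V a)ᴴ = 1)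
    (hp : ∀ a i, 0 ≤ p a i) (hq : ∀ a i, 0 ≤ q a i)
    (hρ : ∀ a, ρ a = V a * Matrix.diagonal (fun i => (p a i : ℂ)) * (V a)ᴴ)
    (hσ : ∀ a, σ a = U a * Matrix.diagonal (fun i => (q a i : ℂ)) * (U a)ᴴ)
    (hs : ∀ a i j, q a i = 0 → Complex.normSq (((U a)ᴴ * V a) i j) * p a j = 0)
    {U' V' ρ' σ' : Matrix κ κ ℂ} {p' q' : κ → ℝ}
    (kU : U'ᴴ * U' = 1) (kU' : U' * U'ᴴ = 1) (kV : V'ᴴ * V' = 1)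
    (kp : ∀ i, 0 ≤ p' i) (kq : ∀ i, 0 ≤ q' i)
    (kρ : ρ' = V' * Matrix.diagonal (fun i => (p' i : ℂ)) * V'ᴴ)
    (kσ : σ' = U' * Matrix.diagonal (fun i => (q' i : ℂ)) * U'ᴴ)
    (ks : ∀ i j, q' i = 0 → Complex.normSq ((U'ᴴ * V') i j) * p' j = 0)
    (Λ : α → Matrix κ κ ℂ → Matrix ι ι ℂ)
    (htr : ∑ a, c a * (ρ a).trace.re = ρ'.trace.re)
    (h1 : ∀ X, (ρ' * X).trace.re = ∑ a, c a * (ρ a * Λ a X).trace.re)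
    (h2 : ∀ X, ∑ a, c a * ((Λ a X)ᴴ * σ a * Λ a X).trace.re ≤ (Xᴴ * σ' * X).trace.re)
    (h3 : ∀ X, ∑ a, c a * (Λ a X * ρ a * (Λ a X)ᴴ).trace.re ≤ (X * ρ' * Xᴴ).trace.re) :
    relEntVal U' V' p' q' ≤ ∑ a, c a * relEntVal (U a) (V a) (p a) (q a) := by
  have hval : ∀ t : ℝ, 0 < t →
      resolventVal U' V' p' q' t ≤ ∑ a, c a * resolventVal (U a) (V a) (p a) (q a) t := by
    intro t ht
    obtain ⟨X, hX⟩ := exists_resolventFunctional_eq kU kV kp kq kρ kσ ht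
    rw [← hX]
    calc resolventFunctional ρ' σ' t X
        ≤ ∑ a, c a * resolventFunctional (ρ a) (σ a) t (Λ a X) := by
          have e : ∑ a, c a * resolventFunctional (ρ a) (σ a) t (Λ a X)
              = 2 * ∑ a, c a * (ρ a * Λ a X).trace.re
                - ∑ a, c a * ((Λ a X)ᴴ * σ a * Λ a X).trace.re
                - t * ∑ a, c a * (Λ a X * ρ a * (Λ a X)ᴴ).trace.re := by
            rw [Finset.mul_sum, Finset.mul_sum, ← Finset.sum_sub_distrib,
              ← Finset.sum_sub_distrib]
            refine Finset.sum_congr rfl fun a _ => ?_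
            rw [resolventFunctional]
            ring
          rw [e, resolventFunctional, h1 X]
          have := mul_le_mul_of_nonneg_left (h3 X) ht.le
          linarith [h2 X]
      _ ≤ _ := Finset.sum_le_sum fun a _ => mul_le_mul_of_nonneg_left
          (resolventFunctional_le (hU a) (hU' a) (hV a) (hV' a) (hp a) (hq a) (hρ a) (hσ a)
            ht _) (hc a)
  let D : ℝ → ℝ := fun t =>
    (∑ a, c a * resolventPrim (U a) (V a) (p a) (q a) t) - resolventPrim U' V' p' q' t
  have hD : ∀ t : ℝ, 0 < t → HasDerivAt D
      ((∑ a, c a * resolventVal (U a) (V a) (p a) (q a) t) - resolventVal U' V' p' q' t) t := by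
    intro t ht
    refine HasDerivAt.sub (HasDerivAt.fun_sum fun a _ => ?_)
      (hasDerivAt_resolventPrim U' V' kp kq ht)
    exact (hasDerivAt_resolventPrim (U a) (V a) (hp a) (hq a) ht).const_mul _
  have hmono : MonotoneOn D (Set.Ioi 0) := by
    refine monotoneOn_of_deriv_nonneg (convex_Ioi 0)
      (fun t ht => (hD t ht).continuousAt.continuousWithinAt) ?_ ?_
    · intro t ht
      rw [interior_Ioi] at ht
      exact (hD t ht).differentiableAt.differentiableWithinAt
    · intro t ht
      rw [interior_Ioi] at ht
      rw [(hD t ht).deriv]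
      linarith [hval t ht]
  have htr' : ∑ a, c a * ∑ j, p a j = ∑ j, p' j := by
    have e1 : ρ'.trace.re = ∑ j, p' j := by
      rw [kρ, trace_spectral kV, Complex.ofReal_re]
    rw [← e1, ← htr]
    refine Finset.sum_congr rfl fun a _ => ?_
    rw [hρ a, trace_spectral (hV a), Complex.ofReal_re]
  have hreg : ∀ δ : ℝ, 0 < δ → δ < 1 →
      relEntReg U' V' p' q' δ ≤ ∑ a, c a * relEntReg (U a) (V a) (p a) (q a) δ := by
    intro δ h0 h1
    have hle : δ ≤ δ⁻¹ := h1.le.trans ((one_le_inv₀ h0).mpr h1.le)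
    have hm := hmono (Set.mem_Ioi.mpr h0) (Set.mem_Ioi.mpr (inv_pos.mpr h0)) hle
    simp only [D] at hm
    have e1 := resolventPrim_inv_sub kp kq kU' kV h0
    have e2 : ∑ a, c a * resolventPrim (U a) (V a) (p a) (q a) δ⁻¹
        - ∑ a, c a * resolventPrim (U a) (V a) (p a) (q a) δ
        = ∑ a, c a * relEntReg (U a) (V a) (p a) (q a) δ
          - (∑ a, c a * ∑ j, p a j) * Real.log δ := by
      rw [← Finset.sum_sub_distrib, Finset.sum_mul, ← Finset.sum_sub_distrib]
      refine Finset.sum_congr rfl fun a _ => ?_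
      have := resolventPrim_inv_sub (hp a) (hq a) (hU' a) (hV a) h0
      linear_combination c a * this
    rw [htr'] at e2
    linarith
  refine le_of_tendsto_of_tendsto (tendsto_relEntReg U' V' ks)
    (tendsto_finsetSum _ fun a _ =>
      (tendsto_relEntReg (U a) (V a) (hs a)).const_mul (c a)) ?_
  filter_upwards [Ioo_mem_nhdsGT (zero_lt_one' ℝ)] with δ hδ
  exact hreg δ hδ.1 hδ.2

/-! ### Entropy inequalities -/

/-- Partial trace over the first factor. -/
def partialTraceL {X Y : Type*} [Fintype X] (M : Matrix (X × Y) (X × Y) ℂ) : Matrix Y Y ℂ :=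
  Matrix.of fun y y' => ∑ x, M (x, y) (x, y')

/-- Partial trace over the middle factor. -/
def partialTraceM {X Y Z : Type*} [Fintype Y] (M : Matrix (X × Y × Z) (X × Y × Z) ℂ) :
    Matrix (X × Z) (X × Z) ℂ :=
  Matrix.of fun p q => ∑ y, M (p.1, y, p.2) (q.1, y, q.2)

/-- The cross entropy of `ρ` relative to the matrix with eigenvectors `U` and eigenvalues `q`. -/
noncomputable def crossEnt {ι : Type*} [Fintype ι] (ρ U : Matrix ι ι ℂ) (q : ι → ℝ) : ℝ :=
  -∑ i, ((Uᴴ * ρ * U) i i).re * Real.log (q i)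

/-- Conditional entropy of the first factor given the second one, in nats. -/
noncomputable def condEnt {X Y : Type*} [Fintype X] [DecidableEq X] [Fintype Y] [DecidableEq Y]
    (ρ : Matrix (X × Y) (X × Y) ℂ) : ℝ :=
  ent ρ - ent (partialTraceL ρ)

section CrossEntropy

variable {ι : Type*} [Fintype ι] [DecidableEq ι]

lemma diag_conj_spectral {U V ρ : Matrix ι ι ℂ} {p : ι → ℝ}
    (hρ : ρ = V * Matrix.diagonal (fun i => (p i : ℂ)) * Vᴴ) (i : ι) :
    ((Uᴴ * ρ * U) i i).re = ∑ j, Complex.normSq ((Uᴴ * V) i j) * p j := by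
  have h : Uᴴ * ρ * U = (Uᴴ * V) * Matrix.diagonal (fun i => (p i : ℂ)) * (Uᴴ * V)ᴴ := by
    rw [hρ, Matrix.conjTranspose_mul, Matrix.conjTranspose_conjTranspose]
    simp only [Matrix.mul_assoc]
  rw [h, Matrix.mul_apply, Complex.re_sum]
  refine Finset.sum_congr rfl fun j _ => ?_
  rw [Matrix.mul_diagonal, Matrix.conjTranspose_apply]
  simp [Complex.normSq_apply]
  ring

lemma relEntVal_eq {U V ρ : Matrix ι ι ℂ} {p q : ι → ℝ} (hU' : U * Uᴴ = 1) (hV : Vᴴ * V = 1)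
    (hρ : ρ = V * Matrix.diagonal (fun i => (p i : ℂ)) * Vᴴ) :
    relEntVal U V p q = -ent ρ + crossEnt ρ U q := by
  have hw := sum_normSq_col (unitary_mul hU' hV)
  rw [ent_eq_of_spectral hV hρ, crossEnt, relEntVal]
  simp only [mul_sub, Finset.sum_sub_distrib, diag_conj_spectral hρ, Finset.sum_mul]
  rw [Finset.sum_comm]
  simp only [← Finset.sum_mul, hw, Real.negMulLog]
  simp only [neg_mul, Finset.sum_neg_distrib, one_mul]
  ring

end CrossEntropy

lemma relEnt_le_sum {α ι κ : Type*} [Fintype α] [Fintype ι] [DecidableEq ι] [Fintype κ]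
    [DecidableEq κ] {c : α → ℝ} (hc : ∀ a, 0 ≤ c a)
    {U ρ σ : α → Matrix ι ι ℂ} {q : α → ι → ℝ}
    (hU : ∀ a, (U a)ᴴ * U a = 1) (hU' : ∀ a, U a * (U a)ᴴ = 1)
    (hq : ∀ a i, 0 ≤ q a i) (hρ : ∀ a, (ρ a).PosSemidef)
    (hσ : ∀ a, σ a = U a * Matrix.diagonal (fun i => (q a i : ℂ)) * (U a)ᴴ)
    (hs : ∀ a i, q a i = 0 → (((U a)ᴴ * ρ a * U a) i i).re = 0)
    {U' ρ' σ' : Matrix κ κ ℂ} {q' : κ → ℝ}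
    (kU : U'ᴴ * U' = 1) (kU' : U' * U'ᴴ = 1)
    (kq : ∀ i, 0 ≤ q' i) (kρ : ρ'.PosSemidef)
    (kσ : σ' = U' * Matrix.diagonal (fun i => (q' i : ℂ)) * U'ᴴ)
    (ks : ∀ i, q' i = 0 → ((U'ᴴ * ρ' * U') i i).re = 0)
    (Λ : α → Matrix κ κ ℂ → Matrix ι ι ℂ)
    (htr : ∑ a, c a * (ρ a).trace.re = ρ'.trace.re)
    (h1 : ∀ X, (ρ' * X).trace.re = ∑ a, c a * (ρ a * Λ a X).trace.re)
    (h2 : ∀ X, ∑ a, c a * ((Λ a X)ᴴ * σ a * Λ a X).trace.re ≤ (Xᴴ * σ' * X).trace.re)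
    (h3 : ∀ X, ∑ a, c a * (Λ a X * ρ a * (Λ a X)ᴴ).trace.re ≤ (X * ρ' * Xᴴ).trace.re) :
    -ent ρ' + crossEnt ρ' U' q' ≤ ∑ a, c a * (-ent (ρ a) + crossEnt (ρ a) (U a) (q a)) := by
  choose V p hV hV' hp hρV using fun a => exists_spectral (hρ a)
  obtain ⟨V', p', kV, -, kp, kρV⟩ := exists_spectral kρ
  have supp : ∀ {ι : Type _} [Fintype ι] [DecidableEq ι] {U V ρ : Matrix ι ι ℂ} {p : ι → ℝ},
      (∀ i, 0 ≤ p i) → ρ = V * Matrix.diagonal (fun i => (p i : ℂ)) * Vᴴ →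
      ∀ i, ((Uᴴ * ρ * U) i i).re = 0 → ∀ j, Complex.normSq ((Uᴴ * V) i j) * p j = 0 := by
    intro ι _ _ U V ρ p hp hρ i h j
    rw [diag_conj_spectral hρ] at h
    exact (Finset.sum_eq_zero_iff_of_nonneg fun j _ =>
      mul_nonneg (Complex.normSq_nonneg _) (hp j)).mp h j (Finset.mem_univ j)
  have key := relEntVal_le_sum hc hU hU' hV hV' hp hq hρV hσ
    (fun a i j h => supp (hp a) (hρV a) i (hs a i h) j) kU kU' kV kp kq kρV kσ
    (fun i j h => by
      have h0 := ks i h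
      rw [diag_conj_spectral kρV] at h0
      exact (Finset.sum_eq_zero_iff_of_nonneg fun j _ =>
        mul_nonneg (Complex.normSq_nonneg _) (kp j)).mp h0 j (Finset.mem_univ j))
    Λ htr h1 h2 h3
  rw [relEntVal_eq kU' kV kρV] at key
  refine key.trans_eq (Finset.sum_congr rfl fun a _ => ?_)
  rw [relEntVal_eq (hU' a) (hV a) (hρV a)]

section PartialTrace

variable {X X' Y Y' Z : Type*} [Fintype X] [Fintype Y]
  [Fintype X'] [Fintype Y'] [Fintype Z]

open Kronecker

lemma partialTraceL_one_kronecker [DecidableEq X] (A : Matrix Y' Y ℂ) (B : Matrix Y Y' ℂ)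
    (M : Matrix (X × Y) (X × Y) ℂ) :
    partialTraceL (((1 : Matrix X X ℂ) ⊗ₖ A) * M * ((1 : Matrix X X ℂ) ⊗ₖ B)) =
      A * partialTraceL M * B := by
  ext y y'
  simp only [partialTraceL, Matrix.of_apply, Matrix.mul_apply, Fintype.sum_prod_type,
    Matrix.kroneckerMap_apply, Matrix.one_apply, ite_mul, one_mul, zero_mul, mul_ite, mul_zero,
    Finset.sum_ite_eq, Finset.sum_ite_irrel, Finset.sum_const_zero, Finset.mem_univ, if_true,
    Finset.sum_ite_eq', Finset.mul_sum, Finset.sum_mul]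
  rw [Finset.sum_comm]
  refine Finset.sum_congr rfl fun y2 _ => ?_
  rw [Finset.sum_comm]

lemma partialTraceL_kronecker_one [DecidableEq X] [DecidableEq Y] {C : Matrix X' X ℂ}
    {D : Matrix X X' ℂ} (h : D * C = 1) (M : Matrix (X × Y) (X × Y) ℂ) :
    partialTraceL ((C ⊗ₖ (1 : Matrix Y Y ℂ)) * M * (D ⊗ₖ (1 : Matrix Y Y ℂ))) =
      partialTraceL M := by
  ext y y'
  have h' : ∀ x2 x1, ∑ x, D x2 x * C x x1 = if x2 = x1 then 1 else 0 := by
    intro x2 x1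
    rw [← Matrix.mul_apply, h, Matrix.one_apply]
  simp only [partialTraceL, Matrix.of_apply, Matrix.mul_apply, Fintype.sum_prod_type,
    Matrix.kroneckerMap_apply, Matrix.one_apply, ite_mul, zero_mul, mul_ite, mul_zero,
    mul_one, Finset.sum_ite_eq, Finset.mem_univ, if_true,
    Finset.sum_ite_eq', Finset.sum_mul]
  rw [Finset.sum_comm]
  calc ∑ x2, ∑ x, ∑ x1, C x x1 * M (x1, y) (x2, y') * D x2 x
      = ∑ x2, ∑ x1, M (x1, y) (x2, y') * ∑ x, D x2 x * C x x1 := by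
        refine Finset.sum_congr rfl fun x2 _ => ?_
        rw [Finset.sum_comm]
        refine Finset.sum_congr rfl fun x1 _ => ?_
        rw [Finset.mul_sum]
        exact Finset.sum_congr rfl fun x _ => by ring
    _ = _ := by simp [h']

lemma trace_partialTraceL (M : Matrix (X × Y) (X × Y) ℂ) : (partialTraceL M).trace = M.trace := by
  simp only [partialTraceL, Matrix.trace, Matrix.diag_apply, Matrix.of_apply,
    Fintype.sum_prod_type]
  rw [Finset.sum_comm]

lemma partialTraceL_sum {α : Type*} [Fintype α] (c : α → ℝ)
    (M : α → Matrix (X × Y) (X × Y) ℂ) :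
    partialTraceL (∑ a, c a • M a) = ∑ a, c a • partialTraceL (M a) := by
  ext y y'
  simp only [partialTraceL, Matrix.of_apply, Matrix.sum_apply, Matrix.smul_apply]
  rw [Finset.sum_comm]
  simp only [Finset.smul_sum]

lemma posSemidef_partialTraceL {M : Matrix (X × Y) (X × Y) ℂ} (hM : M.PosSemidef) :
    (partialTraceL M).PosSemidef := by
  have : partialTraceL M = ∑ x, M.submatrix (fun y => (x, y)) (fun y => (x, y)) := by
    ext y y'
    simp [partialTraceL, Matrix.sum_apply]
  rw [this]
  exact Matrix.posSemidef_sum _ fun x _ => hM.submatrix _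

lemma posSemidef_partialTraceM {M : Matrix (X × Y × Z) (X × Y × Z) ℂ} (hM : M.PosSemidef) :
    (partialTraceM M).PosSemidef := by
  have : partialTraceM M = ∑ y, M.submatrix (fun p : X × Z => (p.1, y, p.2))
      (fun p => (p.1, y, p.2)) := by
    ext p q
    simp [partialTraceM, Matrix.sum_apply]
  rw [this]
  exact Matrix.posSemidef_sum _ fun x _ => hM.submatrix _

end PartialTrace

section Conditional

variable {X Y Z X' Y' : Type*} [Fintype X] [DecidableEq X] [Fintype Y] [DecidableEq Y]
  [Fintype Z] [DecidableEq Z] [Fintype X'] [DecidableEq X'] [Fintype Y'] [DecidableEq Y']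

open Kronecker

lemma diag_re_nonneg {ι : Type*} {A : Matrix ι ι ℂ} (hA : A.PosSemidef) (i : ι) :
    0 ≤ (A i i).re := (Complex.nonneg_iff.mp hA.diag_nonneg).1

/-- Spectral data for `1 ⊗ ρ_Y`, with respect to which the cross entropy of `ρ` is the
entropy of its marginal. -/
lemma exists_spectral_marginal {ρ : Matrix (X × Y) (X × Y) ℂ} (hρ : ρ.PosSemidef) :
    ∃ (U : Matrix (X × Y) (X × Y) ℂ) (q : X × Y → ℝ), Uᴴ * U = 1 ∧ U * Uᴴ = 1 ∧
      (∀ i, 0 ≤ q i) ∧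
      (1 : Matrix X X ℂ) ⊗ₖ partialTraceL ρ
        = U * Matrix.diagonal (fun i => (q i : ℂ)) * Uᴴ ∧
      (∀ i, q i = 0 → ((Uᴴ * ρ * U) i i).re = 0) ∧
      crossEnt ρ U q = ent (partialTraceL ρ) := by
  obtain ⟨W, r, hW, hW', hr, hσ⟩ := exists_spectral (posSemidef_partialTraceL hρ)
  have hct : ((1 : Matrix X X ℂ) ⊗ₖ W)ᴴ = (1 : Matrix X X ℂ) ⊗ₖ Wᴴ := by
    rw [Matrix.conjTranspose_kronecker, Matrix.conjTranspose_one]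
  have hmarg : ∀ y, ∑ x, (((1 : Matrix X X ℂ) ⊗ₖ W)ᴴ * ρ * ((1 : Matrix X X ℂ) ⊗ₖ W)) (x, y) (x, y)
      = (r y : ℂ) := by
    intro y
    have h1 : partialTraceL (((1 : Matrix X X ℂ) ⊗ₖ W)ᴴ * ρ * ((1 : Matrix X X ℂ) ⊗ₖ W))
        = Matrix.diagonal fun i => (r i : ℂ) := by
      rw [hct, partialTraceL_one_kronecker, hσ]
      calc Wᴴ * (W * diagonal (fun i => (r i : ℂ)) * Wᴴ) * W
          = (Wᴴ * W) * diagonal (fun i => (r i : ℂ)) * (Wᴴ * W) := by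
            simp only [Matrix.mul_assoc]
        _ = _ := by rw [hW, Matrix.one_mul, Matrix.mul_one]
    have h2 := congrFun (congrFun h1 y) y
    rwa [Matrix.diagonal_apply_eq] at h2
  have hmarg' : ∀ y, ∑ x, ((((1 : Matrix X X ℂ) ⊗ₖ W)ᴴ * ρ * ((1 : Matrix X X ℂ) ⊗ₖ W)) (x, y) (x, y)).re
      = r y := by
    intro y
    rw [← Complex.re_sum, hmarg, Complex.ofReal_re]
  refine ⟨(1 : Matrix X X ℂ) ⊗ₖ W, fun p => r p.2, ?_, ?_, fun i => hr _, ?_, ?_, ?_⟩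
  · rw [hct, ← Matrix.mul_kronecker_mul, hW, Matrix.one_mul, Matrix.one_kronecker_one]
  · rw [hct, ← Matrix.mul_kronecker_mul, hW', Matrix.one_mul, Matrix.one_kronecker_one]
  · have hd : (Matrix.diagonal fun p : X × Y => (r p.2 : ℂ))
        = (1 : Matrix X X ℂ) ⊗ₖ Matrix.diagonal fun i => (r i : ℂ) := by
      rw [← Matrix.diagonal_one, Matrix.diagonal_kronecker_diagonal]
      simp
    rw [hd, hct, ← Matrix.mul_kronecker_mul, ← Matrix.mul_kronecker_mul, ← hσ]
    simp
  · rintro ⟨x, y⟩ h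
    have h0 := hmarg' y
    simp only at h
    rw [h] at h0
    exact (Finset.sum_eq_zero_iff_of_nonneg fun x _ =>
      diag_re_nonneg (hρ.conjTranspose_mul_mul_same _) _).mp h0 x (Finset.mem_univ x)
  · rw [ent_eq_of_spectral hW hσ, crossEnt, Fintype.sum_prod_type, Finset.sum_comm,
      ← Finset.sum_neg_distrib]
    refine Finset.sum_congr rfl fun y _ => ?_
    change -∑ x, ((((1 : Matrix X X ℂ) ⊗ₖ W)ᴴ * ρ * ((1 : Matrix X X ℂ) ⊗ₖ W)) (x, y) (x, y)).re *
      Real.log (r y) = _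
    rw [← Finset.sum_mul, hmarg' y, Real.negMulLog]
    ring

lemma sum_condEnt_le {α : Type*} [Fintype α] {c : α → ℝ} (hc : ∀ a, 0 ≤ c a)
    {ρ : α → Matrix (X × Y) (X × Y) ℂ} (hρ : ∀ a, (ρ a).PosSemidef)
    {ρ' : Matrix (X' × Y') (X' × Y') ℂ} (kρ : ρ'.PosSemidef)
    (Λ : α → Matrix (X' × Y') (X' × Y') ℂ → Matrix (X × Y) (X × Y) ℂ)
    (htr : ∑ a, c a * (ρ a).trace.re = ρ'.trace.re)
    (h1 : ∀ T, (ρ' * T).trace.re = ∑ a, c a * (ρ a * Λ a T).trace.re)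
    (h2 : ∀ T, ∑ a, c a *
        ((Λ a T)ᴴ * ((1 : Matrix X X ℂ) ⊗ₖ partialTraceL (ρ a)) * Λ a T).trace.re
      ≤ (Tᴴ * ((1 : Matrix X' X' ℂ) ⊗ₖ partialTraceL ρ') * T).trace.re)
    (h3 : ∀ T, ∑ a, c a * (Λ a T * ρ a * (Λ a T)ᴴ).trace.re ≤ (T * ρ' * Tᴴ).trace.re) :
    ∑ a, c a * condEnt (ρ a) ≤ condEnt ρ' := by
  choose U q hU hU' hq hσ hs hX using fun a => exists_spectral_marginal (hρ a)
  obtain ⟨U', q', kU, kU', kq, kσ, ks, kX⟩ := exists_spectral_marginal kρ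
  have := relEnt_le_sum hc hU hU' hq hρ hσ hs kU kU' kq kρ kσ ks Λ htr h1 h2 h3
  rw [kX] at this
  simp only [hX] at this
  have e : ∑ a, c a * (-ent (ρ a) + ent (partialTraceL (ρ a)))
      = -∑ a, c a * condEnt (ρ a) := by
    rw [← Finset.sum_neg_distrib]
    exact Finset.sum_congr rfl fun a _ => by rw [condEnt]; ring
  rw [e] at this
  rw [condEnt]
  linarith

/-- Concavity of the conditional entropy. -/
lemma condEnt_concave {α : Type*} [Fintype α] {c : α → ℝ} (hc : ∀ a, 0 ≤ c a)
    {ρ : α → Matrix (X × Y) (X × Y) ℂ} (hρ : ∀ a, (ρ a).PosSemidef) :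
    ∑ a, c a * condEnt (ρ a) ≤ condEnt (∑ a, c a • ρ a) := by
  refine sum_condEnt_le hc hρ (Matrix.posSemidef_sum _ fun a _ => (hρ a).smul (hc a))
    (fun _ T => T) ?_ (fun T => ?_) (fun T => le_of_eq ?_) (fun T => le_of_eq ?_)
  · simp [Matrix.trace_sum, Matrix.trace_smul]
  · simp [Matrix.sum_mul, Matrix.trace_sum, Matrix.trace_smul]
  · have : (1 : Matrix X X ℂ) ⊗ₖ partialTraceL (∑ a, c a • ρ a)
        = ∑ a, c a • ((1 : Matrix X X ℂ) ⊗ₖ partialTraceL (ρ a)) := by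
      rw [partialTraceL_sum]
      ext p q
      simp only [Matrix.kroneckerMap_apply, Matrix.sum_apply, Matrix.smul_apply, Finset.mul_sum,
        mul_smul_comm]
    rw [this]
    simp [Matrix.sum_mul, Matrix.mul_sum, Matrix.trace_sum, Matrix.trace_smul]
  · simp [Matrix.sum_mul, Matrix.mul_sum, Matrix.trace_sum, Matrix.trace_smul]

/-- Strong subadditivity: conditioning on less increases the conditional entropy. -/
lemma condEnt_le_condEnt_partialTraceM {ρ : Matrix (X × Y × Z) (X × Y × Z) ℂ}
    (hρ : ρ.PosSemidef) : condEnt ρ ≤ condEnt (partialTraceM ρ) := by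
  let Λ : Matrix (X × Z) (X × Z) ℂ → Matrix (X × Y × Z) (X × Y × Z) ℂ := fun T =>
    Matrix.of fun a b => if a.2.1 = b.2.1 then T (a.1, a.2.2) (b.1, b.2.2) else 0
  have hΛmul : ∀ S T, Λ S * Λ T = Λ (S * T) := by
    intro S T
    ext ⟨x, y, z⟩ ⟨x', y', z'⟩
    simp only [Λ, Matrix.mul_apply, Matrix.of_apply, Fintype.sum_prod_type, ite_mul, zero_mul,
      mul_ite, mul_zero]
    split_ifs with h
    · subst h
      refine Finset.sum_congr rfl fun x1 _ => ?_
      rw [Finset.sum_comm]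
      refine Finset.sum_congr rfl fun z1 _ => ?_
      simp
    · refine Finset.sum_eq_zero fun x1 _ => Finset.sum_eq_zero fun y1 _ =>
        Finset.sum_eq_zero fun z1 _ => ?_
      split_ifs with h1 h2
      · exact absurd (h2.trans h1) h
      · rfl
      · rfl
  have hΛct : ∀ T, (Λ T)ᴴ = Λ Tᴴ := by
    intro T
    ext ⟨x, y, z⟩ ⟨x', y', z'⟩
    simp only [Λ, Matrix.conjTranspose_apply, Matrix.of_apply]
    split_ifs with h1 h2 h2
    · rfl
    · exact absurd h1.symm h2
    · exact absurd h2.symm h1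
    · simp
  have hΛtr : ∀ (M : Matrix (X × Y × Z) (X × Y × Z) ℂ) T,
      (M * Λ T).trace = (partialTraceM M * T).trace := by
    intro M T
    simp only [Λ, Matrix.trace, Matrix.diag_apply, Matrix.mul_apply, Matrix.of_apply,
      Fintype.sum_prod_type, mul_ite, mul_zero, partialTraceM, Finset.sum_mul]
    refine Finset.sum_congr rfl fun x _ => ?_
    rw [Finset.sum_comm]
    refine Finset.sum_congr rfl fun z _ => ?_
    rw [Finset.sum_comm]
    refine Finset.sum_congr rfl fun x' _ => ?_
    rw [Finset.sum_comm' (t' := Finset.univ) (s' := fun _ => Finset.univ) (by simp)]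
    calc _ = ∑ y, ∑ z', M (x, y, z) (x', y, z') * T (x', z') (x, z) := by
          rw [Finset.sum_comm]
          refine Finset.sum_congr rfl fun y _ => ?_
          rw [Finset.sum_comm]
          refine Finset.sum_congr rfl fun z' _ => ?_
          simp
      _ = _ := Finset.sum_comm
  have hσ : partialTraceM ((1 : Matrix X X ℂ) ⊗ₖ partialTraceL ρ)
      = (1 : Matrix X X ℂ) ⊗ₖ partialTraceL (partialTraceM ρ) := by
    ext ⟨x, z⟩ ⟨x', z'⟩
    change ∑ y, (1 : Matrix X X ℂ) x x' * ∑ x1, ρ (x1, y, z) (x1, y, z') =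
      (1 : Matrix X X ℂ) x x' * ∑ x1, ∑ y, ρ (x1, y, z) (x1, y, z')
    rw [← Finset.mul_sum, Finset.sum_comm]
  have key := sum_condEnt_le (α := Unit) (c := fun _ => 1) (fun _ => zero_le_one)
    (ρ := fun _ => ρ) (fun _ => hρ) (posSemidef_partialTraceM hρ) (fun _ => Λ) ?_ ?_ ?_ ?_
  · simpa using key
  · have := hΛtr ρ 1
    have h1 : Λ 1 = 1 := by
      ext ⟨x, y, z⟩ ⟨x', y', z'⟩
      simp only [Λ, Matrix.of_apply, Matrix.one_apply, Prod.mk.injEq]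
      split_ifs <;> tauto
    rw [h1, Matrix.mul_one, Matrix.mul_one] at this
    simp [this]
  · intro T
    simp [hΛtr]
  · intro T
    refine le_of_eq ?_
    simp only [Finset.univ_unique, Finset.sum_singleton, one_mul]
    rw [Matrix.trace_mul_cycle, Matrix.trace_mul_comm, hΛct, hΛmul, hΛtr, hσ,
      Matrix.trace_mul_cycle Tᴴ, Matrix.trace_mul_comm (T * Tᴴ)]
  · intro T
    refine le_of_eq ?_
    simp only [Finset.univ_unique, Finset.sum_singleton, one_mul]
    rw [Matrix.trace_mul_cycle, Matrix.trace_mul_comm, hΛct, hΛmul, hΛtr,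
      Matrix.trace_mul_cycle T, Matrix.trace_mul_comm (Tᴴ * T)]

end Conditional

/-! ### A Holevo bound -/

lemma posSemidef_one_sub {ι α : Type*} [Fintype ι] [DecidableEq ι] [Fintype α] [DecidableEq α]
    {F : α → Matrix ι ι ℂ} (hF : ∀ α, (F α).PosSemidef) (hF1 : (1 - ∑ α, F α).PosSemidef) (a : α) :
    (1 - F a).PosSemidef := by
  have e : 1 - F a = (1 - ∑ b, F b) + ∑ b ∈ Finset.univ.erase a, F b := by
    rw [← Finset.add_sum_erase _ _ (Finset.mem_univ a)]
    abel
  rw [e]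
  exact hF1.add (Matrix.posSemidef_sum _ fun b _ => hF b)

section Holevo

variable {ι : Type*} [Fintype ι] [DecidableEq ι]

lemma trace_mul_nonneg_of_posSemidef {A B : Matrix ι ι ℂ} (hA : A.PosSemidef)
    (hB : B.PosSemidef) : 0 ≤ (A * B).trace := by
  obtain ⟨G, rfl⟩ := exists_gram hA
  rw [Matrix.mul_assoc, Matrix.trace_mul_comm]
  exact (hB.conjTranspose_mul_mul_same G).trace_nonneg

lemma posSemidef_mul_one_sub {F : Matrix ι ι ℂ} (hF : F.PosSemidef)
    (hF1 : (1 - F).PosSemidef) : (F * (1 - F)).PosSemidef := by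
  have h : F * (1 - F) = Fᴴ * (1 - F) * F + (1 - F)ᴴ * F * (1 - F) := by
    rw [hF.1.eq, hF1.1.eq]
    noncomm_ring
  rw [h]
  exact (hF1.conjTranspose_mul_mul_same F).add (hF.conjTranspose_mul_mul_same (1 - F))

lemma trace_test_mul_le {F σ : Matrix ι ι ℂ} (hF : F.PosSemidef) (hF1 : (1 - F).PosSemidef)
    (hσ : σ.PosSemidef) (a b : ℂ) :
    (σ * ((a • F + b • (1 - F)) * (star a • F + star b • (1 - F)))).trace.re ≤
      Complex.normSq a * (σ * F).trace.re + Complex.normSq b * (σ * (1 - F)).trace.re := by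
  have h : (a • F + b • (1 - F)) * (star a • F + star b • (1 - F)) =
      (a * star a) • F + (b * star b) • (1 - F)
        - ((a - b) * star (a - b)) • (F * (1 - F)) := by
    simp only [mul_sub, mul_add, add_mul, sub_mul, smul_mul_smul_comm, mul_one, one_mul, smul_sub,
      sub_smul, star_sub]
    module
  have e : ∀ z : ℂ, z * star z = (Complex.normSq z : ℂ) := fun z => Complex.mul_conj z
  have h0 := (Complex.nonneg_iff.mp
    (trace_mul_nonneg_of_posSemidef hσ (posSemidef_mul_one_sub hF hF1))).1
  rw [h, e, e, e]
  simp only [Matrix.mul_sub σ (_ + _), Matrix.mul_add, Matrix.mul_smul, Matrix.trace_sub,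
    Matrix.trace_add, Matrix.trace_smul, smul_eq_mul, Complex.sub_re, Complex.add_re,
    Complex.re_ofReal_mul]
  nlinarith [Complex.normSq_nonneg (a - b)]

lemma mul_log_sub_le {p y : ℝ} (hp : 0 ≤ p) (hy : 0 ≤ y) (h : y = 0 → p = 0) :
    p - y ≤ p * Real.log p - p * Real.log y := by
  rcases hp.eq_or_lt with h0 | h0
  · simp [← h0, hy]
  · have hy' : 0 < y := lt_of_le_of_ne hy fun h' => h0.ne' (h h'.symm)
    have h1 := Real.one_sub_inv_le_log_of_pos (div_pos h0 hy')
    rw [Real.log_div h0.ne' hy'.ne', inv_div] at h1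
    have h2 := mul_le_mul_of_nonneg_left h1 hp
    have h3 : p * (1 - y / p) = p - y := by field_simp
    linarith

/-- Testing two states with `F` bounds their relative entropy from below. -/
lemma test_le_relEnt {U ω σ F : Matrix ι ι ℂ} {q : ι → ℝ} (hU : Uᴴ * U = 1) (hU' : U * Uᴴ = 1)
    (hq : ∀ i, 0 ≤ q i) (hω : IsDensity ω) (hσt : σ.trace = 1)
    (hσ : σ = U * Matrix.diagonal (fun i => (q i : ℂ)) * Uᴴ)
    {c : ℝ} (hc : 0 < c) (hcω : (σ - c • ω).PosSemidef)
    (hF : F.PosSemidef) (hF1 : (1 - F).PosSemidef) {M : ℝ} (hM : 0 < M) :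
    (ω * F).trace.re * Real.log M - M * (σ * F).trace.re ≤ -ent ω + crossEnt ω U q := by
  have hσp : σ.PosSemidef := by
    have := hcω.add (hω.1.smul hc.le)
    rwa [sub_add_cancel] at this
  set p := (ω * F).trace.re with hp
  set s := (σ * F).trace.re with hs
  have hp0 := Complex.nonneg_iff.mp (trace_mul_nonneg_of_posSemidef hω.1 hF)
  have hs0 := Complex.nonneg_iff.mp (trace_mul_nonneg_of_posSemidef hσp hF)
  have hp1 := Complex.nonneg_iff.mp (trace_mul_nonneg_of_posSemidef hω.1 hF1)
  have hs1 := Complex.nonneg_iff.mp (trace_mul_nonneg_of_posSemidef hσp hF1)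
  have hcs := (Complex.nonneg_iff.mp (trace_mul_nonneg_of_posSemidef hcω hF)).1
  have hcs1 := (Complex.nonneg_iff.mp (trace_mul_nonneg_of_posSemidef hcω hF1)).1
  have ep : (ω * F).trace = (p : ℂ) := Complex.ext (by simp [hp]) (by simp [← hp0.2])
  have ep1 : (ω * (1 - F)).trace = ((1 - p : ℝ) : ℂ) := by
    rw [Matrix.mul_sub, Matrix.mul_one, Matrix.trace_sub, hω.2, ep]; simp
  have es1 : (σ * (1 - F)).trace.re = 1 - s := by
    rw [Matrix.mul_sub, Matrix.mul_one, Matrix.trace_sub, hσt, Complex.sub_re, Complex.one_re]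
  simp only [Matrix.sub_mul, Matrix.smul_mul, Matrix.trace_sub, Matrix.trace_smul,
    Complex.sub_re, Complex.real_smul, Complex.re_ofReal_mul, ← hp, ← hs] at hcs
  rw [Matrix.sub_mul, Matrix.trace_sub, Matrix.smul_mul, Matrix.trace_smul, ep1, Complex.sub_re,
    es1, Complex.real_smul, Complex.re_ofReal_mul, Complex.ofReal_re] at hcs1
  rw [ep1, Complex.ofReal_re] at hp1
  rw [es1] at hs1
  have hp00 : 0 ≤ p := hp0.1
  have hs00 : 0 ≤ s := hs0.1
  have sup0 : s = 0 → p = 0 := fun h => by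
    have : 0 ≤ - (c * p) := by linarith
    nlinarith
  have sup1 : 1 - s = 0 → 1 - p = 0 := fun h => by
    have := hp1.1
    nlinarith
  have key := relEnt_le_sum (α := Unit) (c := fun _ => 1) (fun _ => zero_le_one)
    (U := fun _ => U) (ρ := fun _ => ω) (σ := fun _ => σ) (q := fun _ => q)
    (fun _ => hU) (fun _ => hU') (fun _ => hq) (fun _ => hω.1) (fun _ => hσ)
    (fun _ i hi => ?_)
    (U' := (1 : Matrix (Fin 2) (Fin 2) ℂ))
    (ρ' := Matrix.diagonal fun i => ((![p, 1 - p] i : ℝ) : ℂ))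
    (σ' := Matrix.diagonal fun i => ((![s, 1 - s] i : ℝ) : ℂ)) (q' := ![s, 1 - s])
    (by simp) (by simp) ?_ ?_ (by simp) ?_
    (fun _ T => T 0 0 • F + T 1 1 • (1 - F)) ?_ (fun T => ?_) (fun T => ?_) (fun T => ?_)
  · have h1 := mul_log_sub_le hp00 (mul_nonneg hM.le hs00)
      (fun h => sup0 ((mul_eq_zero.mp h).resolve_left hM.ne'))
    have h2 := mul_log_sub_le hp1.1 hs1.1 sup1
    have h3 : p * Real.log (M * s) = p * Real.log M + p * Real.log s := by
      rcases hs00.eq_or_lt with h | h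
      · simp [sup0 h.symm]
      · rw [Real.log_mul hM.ne' h.ne']; ring
    simp only [Finset.univ_unique, Finset.sum_singleton, one_mul] at key
    refine le_trans ?_ key
    rw [ent_diagonal, crossEnt]
    simp [Fin.sum_univ_two, Real.negMulLog]
    linarith
  · have h1 := diag_re_nonneg (hcω.conjTranspose_mul_mul_same U) i
    have h2 := diag_re_nonneg (hω.1.conjTranspose_mul_mul_same U) i
    have h3 : Uᴴ * σ * U = Matrix.diagonal (fun i => (q i : ℂ)) := by
      rw [hσ]
      calc _ = (Uᴴ * U) * Matrix.diagonal (fun i => (q i : ℂ)) * (Uᴴ * U) := by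
            simp only [Matrix.mul_assoc]
        _ = _ := by rw [hU, Matrix.one_mul, Matrix.mul_one]
    rw [Matrix.mul_sub, Matrix.sub_mul, h3, Matrix.sub_apply, Matrix.diagonal_apply_eq, hi,
      Matrix.mul_smul, Matrix.smul_mul, Matrix.smul_apply] at h1
    simp only [Complex.ofReal_zero, zero_sub, Complex.neg_re, Complex.real_smul,
      Complex.re_ofReal_mul] at h1
    nlinarith
  · intro i
    fin_cases i
    · exact hs00
    · exact hs1.1
  · refine Matrix.PosSemidef.diagonal fun i => ?_
    fin_cases i
    · exact Complex.zero_le_real.mpr hp00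
    · exact Complex.zero_le_real.mpr hp1.1
  · intro i hi
    fin_cases i
    · simpa using sup0 hi
    · simpa using sup1 hi
  · simp [hω.2]
  · simp only [Finset.univ_unique, Finset.sum_singleton, one_mul, Matrix.mul_add, Matrix.mul_smul,
      Matrix.trace_add, Matrix.trace_smul, ep, ep1]
    simp [Matrix.trace_fin_two, Matrix.diagonal_mul]
    ring
  · have := trace_test_mul_le hF hF1 hσp (T 0 0) (T 1 1)
    simp only [Finset.univ_unique, Finset.sum_singleton, one_mul]
    rw [Matrix.trace_mul_cycle, Matrix.trace_mul_comm]
    simp only [Matrix.conjTranspose_add, Matrix.conjTranspose_smul, hF.1.eq, hF1.1.eq]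
    refine this.trans ?_
    rw [es1, ← hs]
    rw [trace_conjTranspose_mul_diagonal_mul]
    simp [Fin.sum_univ_two]
    nlinarith [mul_nonneg hs00 (Complex.normSq_nonneg (T 0 1)),
      mul_nonneg hs1.1 (Complex.normSq_nonneg (T 1 0))]
  · have := trace_test_mul_le hF hF1 hω.1 (star (T 0 0)) (star (T 1 1))
    simp only [Finset.univ_unique, Finset.sum_singleton, one_mul]
    rw [Matrix.trace_mul_cycle, Matrix.trace_mul_comm]
    simp only [Matrix.conjTranspose_add, Matrix.conjTranspose_smul, hF.1.eq, hF1.1.eq]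
    simp only [star_star] at this
    refine this.trans ?_
    rw [ep1, ← hp, Complex.ofReal_re]
    rw [trace_mul_diagonal_mul_conjTranspose]
    simp [Fin.sum_univ_two]
    nlinarith [mul_nonneg hp1.1 (Complex.normSq_nonneg (T 0 1)),
      mul_nonneg hp00 (Complex.normSq_nonneg (T 1 0))]

/-- Holevo bound for the success probability of decoding equiprobable states. -/
lemma holevo_bound {M : ℕ} (hM : 1 ≤ M) {ω F : Fin M → Matrix ι ι ℂ}
    (hω : ∀ α, IsDensity (ω α)) (hF : ∀ α, (F α).PosSemidef)
    (hF1 : (1 - ∑ α, F α).PosSemidef) :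
    ((M : ℝ)⁻¹ * ∑ α, (F α * ω α).trace.re) * Real.log M - 1 ≤
      ent (∑ α, (M : ℝ)⁻¹ • ω α) - (M : ℝ)⁻¹ * ∑ α, ent (ω α) := by
  have hM0 : (0 : ℝ) < M := by exact_mod_cast hM
  set c : ℝ := (M : ℝ)⁻¹ with hc
  have hc0 : 0 < c := inv_pos.mpr hM0
  set σ := ∑ α, c • ω α with hσdef
  have hσp : σ.PosSemidef := Matrix.posSemidef_sum _ fun α _ => (hω α).1.smul hc0.le
  have hσt : σ.trace = 1 := by
    rw [hσdef, Matrix.trace_sum]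
    simp only [Matrix.trace_smul, (hω _).2, Finset.sum_const, Finset.card_univ, Fintype.card_fin]
    simp [hc]
    field_simp
  obtain ⟨U, q, hU, hU', hq, hσ⟩ := exists_spectral hσp
  have hdom : ∀ α, (σ - c • ω α).PosSemidef := fun α => by
    rw [hσdef, ← Finset.add_sum_erase _ _ (Finset.mem_univ α), add_sub_cancel_left]
    exact Matrix.posSemidef_sum _ fun α _ => (hω α).1.smul hc0.le
  have key := fun α => test_le_relEnt hU hU' hq (hω α) hσt hσ hc0 (hdom α) (hF α)
    (posSemidef_one_sub hF hF1 α) hM0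
  have hsum := Finset.sum_le_sum fun α (_ : α ∈ Finset.univ) => key α
  have hcross : c * ∑ α, crossEnt (ω α) U q = ent σ := by
    rw [ent_eq_of_spectral hU hσ]
    have h3 : Uᴴ * σ * U = Matrix.diagonal (fun i => (q i : ℂ)) := by
      rw [hσ]
      calc _ = (Uᴴ * U) * Matrix.diagonal (fun i => (q i : ℂ)) * (Uᴴ * U) := by
            simp only [Matrix.mul_assoc]
        _ = _ := by rw [hU, Matrix.one_mul, Matrix.mul_one]
    have h4 : ∀ i, ∑ α, c * ((Uᴴ * ω α * U) i i).re = q i := fun i => by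
      have := congrArg Complex.re (congrFun (congrFun h3 i) i)
      rw [Matrix.diagonal_apply_eq, Complex.ofReal_re, hσdef, Matrix.mul_sum, Matrix.sum_mul,
        Matrix.sum_apply, Complex.re_sum] at this
      rw [← this]
      refine Finset.sum_congr rfl fun α _ => ?_
      simp
    simp only [crossEnt, Finset.sum_neg_distrib, mul_neg]
    rw [Finset.sum_comm, Finset.mul_sum, ← Finset.sum_neg_distrib]
    refine Finset.sum_congr rfl fun i _ => ?_
    rw [← Finset.sum_mul, ← mul_assoc, Finset.mul_sum, h4, Real.negMulLog]
    ring
  have htest : ∑ α, (σ * F α).trace.re ≤ 1 := by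
    have := (Complex.nonneg_iff.mp (trace_mul_nonneg_of_posSemidef hσp hF1)).1
    rw [Matrix.mul_sub, Matrix.mul_one, Matrix.trace_sub, hσt, Matrix.mul_sum, Matrix.trace_sum,
      Complex.sub_re, Complex.re_sum, Complex.one_re] at this
    linarith
  simp only [Finset.sum_sub_distrib, Finset.sum_add_distrib, Finset.sum_neg_distrib,
    ← Finset.sum_mul, ← Finset.mul_sum] at hsum
  have h5 := mul_le_mul_of_nonneg_left hsum hc0.le
  have hcM : c * M = 1 := inv_mul_cancel₀ hM0.ne'
  simp only [Matrix.trace_mul_comm (F _)]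
  have h6 : c * (M * ∑ α, (σ * F α).trace.re) ≤ 1 := by
    rw [← mul_assoc, hcM, one_mul]; exact htest
  nlinarith

end Holevo

/-! ### Consequences of strong subadditivity -/

section Marginals

variable {B B' E E' R X Y : Type*} [Fintype B] [DecidableEq B] [Fintype B'] [DecidableEq B']
  [Fintype E] [DecidableEq E] [Fintype E'] [DecidableEq E'] [Fintype R] [DecidableEq R]
  [Fintype X] [DecidableEq X] [Fintype Y] [DecidableEq Y]

lemma posSemidef_partialTraceR {M : Matrix (X × Y) (X × Y) ℂ} (hM : M.PosSemidef) :
    (partialTraceR M).PosSemidef := by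
  have : partialTraceR M = ∑ y, M.submatrix (fun x => (x, y)) (fun x => (x, y)) := by
    ext x x'
    simp [partialTraceR, Matrix.sum_apply]
  rw [this]
  exact Matrix.posSemidef_sum _ fun y _ => hM.submatrix _

lemma trace_partialTraceR (M : Matrix (X × Y) (X × Y) ℂ) :
    (partialTraceR M).trace = M.trace := by
  simp only [partialTraceR, Matrix.trace, Matrix.diag_apply, Matrix.of_apply,
    Fintype.sum_prod_type]

lemma IsDensity.partialTraceL {M : Matrix (X × Y) (X × Y) ℂ} (hM : IsDensity M) :
    IsDensity (partialTraceL M) :=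
  ⟨posSemidef_partialTraceL hM.1, by rw [trace_partialTraceL, hM.2]⟩

lemma IsDensity.partialTraceR {M : Matrix (X × Y) (X × Y) ℂ} (hM : IsDensity M) :
    IsDensity (partialTraceR M) :=
  ⟨posSemidef_partialTraceR hM.1, by rw [trace_partialTraceR, hM.2]⟩

/-- The marginal of a state of `(B × E) × R` on `B × R`. -/
def outerMarginal (τ : Matrix ((B × E) × R) ((B × E) × R) ℂ) : Matrix (B × R) (B × R) ℂ :=
  Matrix.of fun p q => ∑ e, τ ((p.1, e), p.2) ((q.1, e), q.2)

/-- Weak monotonicity of the entropy. -/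
lemma ent_add_ent_le {τ : Matrix ((B × E) × R) ((B × E) × R) ℂ} (hτ : τ.PosSemidef) :
    ent (partialTraceL τ) + ent (partialTraceL (partialTraceR τ)) ≤
      ent (outerMarginal τ) + ent (partialTraceR τ) := by
  obtain ⟨G, hG⟩ := exists_gram hτ
  have hτa : ∀ i j, τ i j = ∑ c, G i c * star (G j c) := fun i j => by
    rw [hG, Matrix.mul_apply]
    simp only [Matrix.conjTranspose_apply]
  let N : Matrix (B × ((B × E) × R) × E) R ℂ :=
    Matrix.of fun p r => G ((p.1, p.2.2), r) p.2.1
  let P : Matrix (((B × E) × R) × E) (B × R) ℂ :=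
    Matrix.of fun p q => G ((q.1, p.2), q.2) p.1
  have h1 : ent (N * Nᴴ) = ent (partialTraceL τ) := by
    rw [ent_mul_comm, ← ent_transpose]
    congr 1
    ext r r'
    simp only [N, Matrix.transpose_apply, Matrix.mul_apply, Matrix.conjTranspose_apply,
      Matrix.of_apply, partialTraceL, hτa,
      Fintype.sum_prod_type (α₁ := B) (α₂ := ((B × E) × R) × E),
      Fintype.sum_prod_type (α₁ := (B × E) × R) (α₂ := E),
      Fintype.sum_prod_type (α₁ := B) (α₂ := E)]
    refine Finset.sum_congr rfl fun b _ => ?_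
    rw [Finset.sum_comm]
    exact Finset.sum_congr rfl fun e _ => Finset.sum_congr rfl fun c _ => mul_comm _ _
  have h2 : ent (partialTraceL (N * Nᴴ)) = ent (outerMarginal τ) := by
    have : partialTraceL (N * Nᴴ) = P * Pᴴ := by
      ext ⟨c, e⟩ ⟨c', e'⟩
      simp only [N, P, Matrix.mul_apply, Matrix.conjTranspose_apply,
        Matrix.of_apply, partialTraceL, Fintype.sum_prod_type (α₁ := B) (α₂ := R)]
    rw [this, ent_mul_comm, ← ent_transpose]
    congr 1
    ext ⟨b, r⟩ ⟨b', r'⟩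
    simp only [P, Matrix.transpose_apply, Matrix.mul_apply, Matrix.conjTranspose_apply,
      Matrix.of_apply, outerMarginal, hτa, Fintype.sum_prod_type (α₁ := (B × E) × R) (α₂ := E)]
    rw [Finset.sum_comm]
    exact Finset.sum_congr rfl fun e _ => Finset.sum_congr rfl fun c _ => mul_comm _ _
  have h3 : partialTraceM (N * Nᴴ) = partialTraceR τ := by
    ext ⟨b, e⟩ ⟨b', e'⟩
    simp only [N, Matrix.mul_apply, Matrix.conjTranspose_apply,
      Matrix.of_apply, partialTraceM, partialTraceR, hτa]
    rw [Finset.sum_comm]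
  have key := condEnt_le_condEnt_partialTraceM (Matrix.posSemidef_self_mul_conjTranspose N)
  rw [condEnt, condEnt, h1, h2, h3] at key
  linarith

/-- The marginal of a state of `(B × B') × (E × E')` on `B × E`. -/
def marginalFst (μ : Matrix ((B × B') × (E × E')) ((B × B') × (E × E')) ℂ) :
    Matrix (B × E) (B × E) ℂ :=
  Matrix.of fun p q => ∑ z : B' × E', μ ((p.1, z.1), (p.2, z.2)) ((q.1, z.1), (q.2, z.2))

/-- The marginal of a state of `(B × B') × (E × E')` on `B' × E'`. -/
def marginalSnd (μ : Matrix ((B × B') × (E × E')) ((B × B') × (E × E')) ℂ) :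
    Matrix (B' × E') (B' × E') ℂ :=
  Matrix.of fun p q => ∑ z : B × E, μ ((z.1, p.1), (z.2, p.2)) ((z.1, q.1), (z.2, q.2))

/-- Subadditivity of the conditional entropy. -/
lemma condEnt_le_add {μ : Matrix ((B × B') × (E × E')) ((B × B') × (E × E')) ℂ}
    (hμ : μ.PosSemidef) : condEnt μ ≤ condEnt (marginalFst μ) + condEnt (marginalSnd μ) := by
  let e₁ : B × (B' × E') × E ≃ (B × B') × (E × E') :=
    ⟨fun p => ((p.1, p.2.1.1), (p.2.2, p.2.1.2)), fun p => (p.1.1, (p.1.2, p.2.2), p.2.1),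
      fun _ => rfl, fun _ => rfl⟩
  let e₂ : (B' × E') × E ≃ B' × E × E' :=
    ⟨fun p => (p.1.1, p.2, p.1.2), fun p => ((p.1, p.2.2), p.2.1), fun _ => rfl, fun _ => rfl⟩
  let μ₂ : Matrix (B' × E × E') (B' × E × E') ℂ :=
    Matrix.of fun p q => ∑ b, μ ((b, p.1), p.2) ((b, q.1), q.2)
  have hμ₂ : μ₂.PosSemidef := by
    have : μ₂ = ∑ b, μ.submatrix (fun p : B' × E × E' => ((b, p.1), p.2))
        (fun p => ((b, p.1), p.2)) := by
      ext p q
      simp [μ₂, Matrix.sum_apply]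
    rw [this]
    exact Matrix.posSemidef_sum _ fun x _ => hμ.submatrix _
  have k₁ := condEnt_le_condEnt_partialTraceM (hμ.submatrix e₁)
  have k₂ := condEnt_le_condEnt_partialTraceM hμ₂
  have a₁ : partialTraceL (μ.submatrix e₁ e₁) = μ₂.submatrix e₂ e₂ := rfl
  have a₂ : partialTraceM (μ.submatrix e₁ e₁) = marginalFst μ := rfl
  have a₃ : partialTraceL μ₂ = partialTraceL μ := by
    ext y y'
    simp only [partialTraceL, μ₂, Matrix.of_apply, Fintype.sum_prod_type]
    rw [Finset.sum_comm]
  have a₄ : partialTraceM μ₂ = marginalSnd μ := by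
    ext ⟨y, z⟩ ⟨y', z'⟩
    simp only [partialTraceM, μ₂, Matrix.of_apply, marginalSnd, Fintype.sum_prod_type]
    rw [Finset.sum_comm]
  rw [a₂, condEnt, a₁, ent_submatrix, ent_submatrix] at k₁
  rw [a₄, condEnt, a₃] at k₂
  rw [condEnt]
  linarith

/-- Subadditivity of the entropy. -/
lemma ent_le_add {ρ : Matrix (X × Y) (X × Y) ℂ} (hρ : IsDensity ρ) :
    ent ρ ≤ ent (partialTraceR ρ) + ent (partialTraceL ρ) := by
  let e₁ : X × Y × Unit ≃ X × Y :=
    ⟨fun p => (p.1, p.2.1), fun p => (p.1, p.2, ()), fun _ => rfl, fun _ => rfl⟩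
  have k := condEnt_le_condEnt_partialTraceM (hρ.1.submatrix e₁)
  have a₁ : partialTraceL (ρ.submatrix e₁ e₁)
    = (partialTraceL ρ).submatrix (Equiv.prodUnique Y Unit) (Equiv.prodUnique Y Unit) := rfl
  have a₂ : partialTraceM (ρ.submatrix e₁ e₁)
    = (partialTraceR ρ).submatrix (Equiv.prodUnique X Unit) (Equiv.prodUnique X Unit) := rfl
  have a₃ : IsDensity (partialTraceM (ρ.submatrix e₁ e₁)) := by
    refine ⟨posSemidef_partialTraceM (hρ.1.submatrix e₁), ?_⟩
    rw [a₂, ← trace_partialTraceR ρ |>.trans hρ.2]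
    exact Equiv.sum_comp (Equiv.prodUnique X Unit) fun x => partialTraceR ρ x x
  rw [condEnt, condEnt, ent_of_unique a₃.partialTraceL, a₁, a₂, ent_submatrix, ent_submatrix,
    ent_submatrix] at k
  linarith

/-- Concavity of the entropy. -/
lemma ent_concave {α : Type*} [Fintype α] {c : α → ℝ} (hc : ∀ a, 0 ≤ c a) (hc1 : ∑ a, c a = 1)
    {ρ : α → Matrix X X ℂ} (hρ : ∀ a, IsDensity (ρ a)) :
    ∑ a, c a * ent (ρ a) ≤ ent (∑ a, c a • ρ a) := by
  let e : X × Unit ≃ X := Equiv.prodUnique X Unit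
  have tr : ∀ A : Matrix X X ℂ, (A.submatrix e e).trace = A.trace := fun A =>
    Equiv.sum_comp e fun x => A x x
  have key : ∀ A : Matrix X X ℂ, IsDensity A → condEnt (A.submatrix e e) = ent A := by
    intro A hA
    have : IsDensity (A.submatrix e e) := ⟨hA.1.submatrix e, by rw [tr, hA.2]⟩
    rw [condEnt, ent_of_unique this.partialTraceL, ent_submatrix, sub_zero]
  have h := condEnt_concave hc (ρ := fun a => (ρ a).submatrix e e) fun a => (hρ a).1.submatrix e
  have hs : ∑ a, c a • (ρ a).submatrix e e = (∑ a, c a • ρ a).submatrix e e := by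
    ext p q
    simp [Matrix.sum_apply]
  have hd : IsDensity (∑ a, c a • ρ a) := by
    refine ⟨Matrix.posSemidef_sum _ fun a _ => (hρ a).1.smul (hc a), ?_⟩
    simp only [Matrix.trace_sum, Matrix.trace_smul, (hρ _).2, ← Finset.sum_smul, hc1, one_smul]
  rw [hs, key _ hd] at h
  simpa only [key _ (hρ _)] using h

end Marginals

/-! ### Channels as isometries -/

section Isometry

variable {A A' B B' E E' R X Y : Type*} [Fintype A] [DecidableEq A] [Fintype A'] [DecidableEq A']
  [Fintype B] [DecidableEq B] [Fintype B'] [DecidableEq B']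
  [Fintype E] [DecidableEq E] [Fintype E'] [DecidableEq E'] [Fintype R] [DecidableEq R]
  [Fintype X] [DecidableEq X] [Fintype Y] [DecidableEq Y]

open Kronecker

lemma IsDensity.conj_isometry {ρ : Matrix A A ℂ} (hρ : IsDensity ρ) {V : Matrix X A ℂ}
    (hV : Vᴴ * V = 1) : IsDensity (V * ρ * Vᴴ) :=
  ⟨hρ.1.mul_mul_conjTranspose_same V, by
    rw [Matrix.trace_mul_cycle, hV, Matrix.one_mul, hρ.2]⟩

lemma IsDensity.sum_smul {α : Type*} [Fintype α] {c : α → ℝ} (hc : ∀ a, 0 ≤ c a)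
    (hc1 : ∑ a, c a = 1) {ρ : α → Matrix A A ℂ} (hρ : ∀ a, IsDensity (ρ a)) :
    IsDensity (∑ a, c a • ρ a) := by
  refine ⟨Matrix.posSemidef_sum _ fun a _ => (hρ a).1.smul (hc a), ?_⟩
  simp only [Matrix.trace_sum, Matrix.trace_smul, (hρ _).2, ← Finset.sum_smul, hc1, one_smul]

lemma kronecker_isometry {V : Matrix X A ℂ} {V' : Matrix Y A' ℂ} (hV : Vᴴ * V = 1)
    (hV' : V'ᴴ * V' = 1) : (V ⊗ₖ V')ᴴ * (V ⊗ₖ V') = 1 := by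
  rw [Matrix.conjTranspose_kronecker, ← Matrix.mul_kronecker_mul, hV, hV',
    Matrix.one_kronecker_one]

lemma partialTraceL_conj_kronecker {V : Matrix X A ℂ} (V' : Matrix Y A' ℂ) (hV : Vᴴ * V = 1)
    (ρ : Matrix (A × A') (A × A') ℂ) :
    partialTraceL ((V ⊗ₖ V') * ρ * (V ⊗ₖ V')ᴴ) = V' * partialTraceL ρ * V'ᴴ := by
  have h1 : V ⊗ₖ V' = (V ⊗ₖ (1 : Matrix Y Y ℂ)) * ((1 : Matrix A A ℂ) ⊗ₖ V') := by
    rw [← Matrix.mul_kronecker_mul, Matrix.mul_one, Matrix.one_mul]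
  have h2 : (V ⊗ₖ V')ᴴ = ((1 : Matrix A A ℂ) ⊗ₖ V'ᴴ) * (Vᴴ ⊗ₖ (1 : Matrix Y Y ℂ)) := by
    rw [Matrix.conjTranspose_kronecker, ← Matrix.mul_kronecker_mul, Matrix.mul_one,
      Matrix.one_mul]
  have h3 : (V ⊗ₖ V') * ρ * (V ⊗ₖ V')ᴴ = (V ⊗ₖ (1 : Matrix Y Y ℂ)) *
      (((1 : Matrix A A ℂ) ⊗ₖ V') * ρ * ((1 : Matrix A A ℂ) ⊗ₖ V'ᴴ)) *
        (Vᴴ ⊗ₖ (1 : Matrix Y Y ℂ)) := by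
    rw [h2, h1]
    simp only [Matrix.mul_assoc]
  rw [h3, partialTraceL_kronecker_one hV, partialTraceL_one_kronecker]

lemma partialTraceR_conj_kronecker (V : Matrix X A ℂ) {V' : Matrix Y A' ℂ} (hV' : V'ᴴ * V' = 1)
    (ρ : Matrix (A × A') (A × A') ℂ) :
    partialTraceR ((V ⊗ₖ V') * ρ * (V ⊗ₖ V')ᴴ) = V * partialTraceR ρ * Vᴴ := by
  have h1 : (V' ⊗ₖ V) = (V ⊗ₖ V').submatrix (Equiv.prodComm Y X) (Equiv.prodComm A' A) := by
    ext p q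
    simp [Matrix.kroneckerMap_apply, mul_comm]
  have h2 : (V' ⊗ₖ V)ᴴ
      = (V ⊗ₖ V')ᴴ.submatrix (Equiv.prodComm A' A) (Equiv.prodComm Y X) := by
    rw [h1, Matrix.conjTranspose_submatrix]
  have h := partialTraceL_conj_kronecker V hV'
    (ρ.submatrix (Equiv.prodComm A' A) (Equiv.prodComm A' A))
  rw [h2, h1, Matrix.submatrix_mul_equiv, Matrix.submatrix_mul_equiv] at h
  exact h

/-- The product of two bipartite isometries, with outputs and environments grouped. -/
def pairIso (V : Matrix (B × E) A ℂ) (V' : Matrix (B' × E') A' ℂ) :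
    Matrix ((B × B') × (E × E')) (A × A') ℂ :=
  Matrix.of fun p q => V (p.1.1, p.2.1) q.1 * V' (p.1.2, p.2.2) q.2

lemma pairIso_eq (V : Matrix (B × E) A ℂ) (V' : Matrix (B' × E') A' ℂ) :
    pairIso V V' = (V ⊗ₖ V').submatrix (Equiv.prodProdProdComm B B' E E') (Equiv.refl _) := rfl

lemma pairIso_conj (V : Matrix (B × E) A ℂ) (V' : Matrix (B' × E') A' ℂ)
    (ρ : Matrix (A × A') (A × A') ℂ) :
    pairIso V V' * ρ * (pairIso V V')ᴴ = ((V ⊗ₖ V') * ρ * (V ⊗ₖ V')ᴴ).submatrix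
      (Equiv.prodProdProdComm B B' E E') (Equiv.prodProdProdComm B B' E E') := by
  rw [← Matrix.submatrix_mul_equiv _ _ _ (Equiv.refl _), ← Matrix.submatrix_mul_equiv _ _ _
    (Equiv.refl _), pairIso_eq, Matrix.conjTranspose_submatrix]
  rfl

lemma pairIso_isometry {V : Matrix (B × E) A ℂ} {V' : Matrix (B' × E') A' ℂ} (hV : Vᴴ * V = 1)
    (hV' : V'ᴴ * V' = 1) : (pairIso V V')ᴴ * pairIso V V' = 1 := by
  rw [pairIso_eq, Matrix.conjTranspose_submatrix, Matrix.submatrix_mul_equiv,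
    kronecker_isometry hV hV']
  simp

lemma condEnt_pairIso_le {V : Matrix (B × E) A ℂ} {V' : Matrix (B' × E') A' ℂ}
    (hV : Vᴴ * V = 1) (hV' : V'ᴴ * V' = 1) {ρ : Matrix (A × A') (A × A') ℂ}
    (hρ : ρ.PosSemidef) :
    condEnt (pairIso V V' * ρ * (pairIso V V')ᴴ) ≤
      condEnt (V * partialTraceR ρ * Vᴴ) + condEnt (V' * partialTraceL ρ * V'ᴴ) := by
  refine (condEnt_le_add (hρ.mul_mul_conjTranspose_same _)).trans_eq ?_
  rw [← partialTraceR_conj_kronecker V hV', ← partialTraceL_conj_kronecker V' hV, pairIso_conj]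
  rfl

lemma ent_pairIso_le {V : Matrix (B × E) A ℂ} {V' : Matrix (B' × E') A' ℂ}
    (hV : Vᴴ * V = 1) (hV' : V'ᴴ * V' = 1) {ρ : Matrix (A × A') (A × A') ℂ}
    (hρ : IsDensity ρ) :
    ent (partialTraceR (pairIso V V' * ρ * (pairIso V V')ᴴ)) ≤
      ent (partialTraceR (V * partialTraceR ρ * Vᴴ))
        + ent (partialTraceR (V' * partialTraceL ρ * V'ᴴ)) := by
  refine (ent_le_add (hρ.conj_isometry (pairIso_isometry hV hV')).partialTraceR).trans_eq ?_
  rw [← partialTraceR_conj_kronecker V hV', ← partialTraceL_conj_kronecker V' hV, pairIso_conj]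
  congr 2
  · ext b b'
    simp only [partialTraceR, Matrix.of_apply, Matrix.submatrix_apply, Fintype.sum_prod_type,
      Equiv.prodProdProdComm_apply]
    rw [Finset.sum_comm]
  · ext b b'
    simp only [partialTraceR, partialTraceL, Matrix.of_apply, Matrix.submatrix_apply,
      Fintype.sum_prod_type, Equiv.prodProdProdComm_apply]
    conv_lhs => enter [2, x]; rw [Finset.sum_comm]
    rw [Finset.sum_comm]

/-- The `N`-fold tensor power of a bipartite isometry. -/
def powIso (N : ℕ) (V : Matrix (B × E) A ℂ) :
    Matrix ((Fin N → B) × (Fin N → E)) (Fin N → A) ℂ :=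
  Matrix.of fun p a => ∏ j, V (p.1 j, p.2 j) (a j)

lemma powIso_succ (N : ℕ) (V : Matrix (B × E) A ℂ) :
    powIso (N + 1) V = (pairIso V (powIso N V)).submatrix
      (Equiv.prodCongr (Fin.consEquiv fun _ => B).symm (Fin.consEquiv fun _ => E).symm)
      (Fin.consEquiv fun _ => A).symm := by
  ext p a
  simp [powIso, pairIso, Fin.prod_univ_succ, Fin.consEquiv, Fin.tail]

lemma powIso_isometry {V : Matrix (B × E) A ℂ} (hV : Vᴴ * V = 1) (N : ℕ) :
    (powIso N V)ᴴ * powIso N V = 1 := by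
  induction N with
  | zero =>
    ext a a'
    rw [Subsingleton.elim a a']
    simp [powIso, Matrix.mul_apply]
  | succ N ih =>
    rw [powIso_succ, Matrix.conjTranspose_submatrix, Matrix.submatrix_mul_equiv,
      pairIso_isometry hV ih]
    simp

/-- Subadditivity of the entropies of a tensor power of a channel; the single-site states do
not depend on the channel. -/
lemma exists_sites (N : ℕ) : ∃ T : Fin N → Matrix (Fin N → A) (Fin N → A) ℂ → Matrix A A ℂ,
    (∀ j, IsLinearMap ℝ (T j)) ∧ (∀ j ρ, IsDensity ρ → IsDensity (T j ρ)) ∧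
    ∀ V : Matrix (B × E) A ℂ, Vᴴ * V = 1 → ∀ ρ, IsDensity ρ →
      ent (partialTraceR (powIso N V * ρ * (powIso N V)ᴴ)) ≤
          ∑ j, ent (partialTraceR (V * T j ρ * Vᴴ)) ∧
        condEnt (powIso N V * ρ * (powIso N V)ᴴ) ≤ ∑ j, condEnt (V * T j ρ * Vᴴ) := by
  induction N with
  | zero =>
    refine ⟨fun j => j.elim0, fun j => j.elim0, fun j => j.elim0, fun V hV ρ hρ => ?_⟩
    have h := hρ.conj_isometry (powIso_isometry hV 0)
    have h' := h.partialTraceR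
    have h'' := h.partialTraceL
    have : Unique ((Fin 0 → B) × (Fin 0 → E)) :=
      ⟨⟨default⟩, fun _ => Subsingleton.elim _ _⟩
    rw [condEnt, ent_of_unique h, ent_of_unique h', ent_of_unique h'']
    simp
  | succ N ih =>
    obtain ⟨T, hTl, hTd, hT⟩ := ih
    let e : (Fin (N + 1) → A) ≃ A × (Fin N → A) := (Fin.consEquiv fun _ => A).symm
    have hd : ∀ ρ, IsDensity ρ → IsDensity (ρ.submatrix e.symm e.symm) := fun ρ hρ =>
      ⟨hρ.1.submatrix _, (Equiv.sum_comp e.symm fun x => ρ x x).trans hρ.2⟩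
    refine ⟨Fin.cons (fun ρ => partialTraceR (ρ.submatrix e.symm e.symm))
      fun j ρ => T j (partialTraceL (ρ.submatrix e.symm e.symm)), fun j => ?_, fun j => ?_,
      fun V hV ρ hρ => ?_⟩
    · induction j using Fin.cases with
      | zero =>
        constructor
        · intro ρ σ
          ext a a'
          simp [partialTraceR, Finset.sum_add_distrib]
        · intro c ρ
          ext a a'
          simp [partialTraceR, Finset.mul_sum]
      | succ j =>
        have h1 : ∀ ρ σ : Matrix (Fin (N + 1) → A) (Fin (N + 1) → A) ℂ,
            partialTraceL ((ρ + σ).submatrix e.symm e.symm) =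
              partialTraceL (ρ.submatrix e.symm e.symm)
                + partialTraceL (σ.submatrix e.symm e.symm) := by
          intro ρ σ
          ext a a'
          simp [partialTraceL, Finset.sum_add_distrib]
        have h2 : ∀ (c : ℝ) (ρ : Matrix (Fin (N + 1) → A) (Fin (N + 1) → A) ℂ),
            partialTraceL ((c • ρ).submatrix e.symm e.symm) =
              c • partialTraceL (ρ.submatrix e.symm e.symm) := by
          intro c ρ
          ext a a'
          simp [partialTraceL, Finset.mul_sum]
        constructor
        · intro ρ σ
          simp only [Fin.cons_succ]
          rw [h1, (hTl j).map_add]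
        · intro c ρ
          simp only [Fin.cons_succ]
          rw [h2, (hTl j).map_smul]
    · induction j using Fin.cases with
      | zero => exact fun ρ hρ => (hd ρ hρ).partialTraceR
      | succ j => exact fun ρ hρ => hTd j _ (hd ρ hρ).partialTraceL
    · have hρ' := hd ρ hρ
      obtain ⟨t1, t2⟩ := hT V hV _ hρ'.partialTraceL
      let f : (Fin (N + 1) → B) × (Fin (N + 1) → E) ≃ (B × (Fin N → B)) × (E × (Fin N → E)) :=
        Equiv.prodCongr (Fin.consEquiv fun _ => B).symm (Fin.consEquiv fun _ => E).symm
      have hW : powIso (N + 1) V * ρ * (powIso (N + 1) V)ᴴ =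
          (pairIso V (powIso N V) * ρ.submatrix e.symm e.symm *
            (pairIso V (powIso N V))ᴴ).submatrix f f := by
        rw [powIso_succ, ← Matrix.submatrix_mul_equiv _ _ _ e, ← Matrix.submatrix_mul_equiv _ _ _
          e, Matrix.conjTranspose_submatrix, Matrix.submatrix_submatrix]
        simp [e, f]
      have c1 := condEnt_pairIso_le hV (powIso_isometry hV N) hρ'.1
      have c2 := ent_pairIso_le hV (powIso_isometry hV N) hρ'
      set μ := pairIso V (powIso N V) * ρ.submatrix e.symm e.symm * (pairIso V (powIso N V))ᴴ
        with hμ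
      have r1 : partialTraceR (μ.submatrix f f) = (partialTraceR μ).submatrix
          (Fin.consEquiv fun _ => B).symm (Fin.consEquiv fun _ => B).symm := by
        ext b b'
        exact Equiv.sum_comp (Fin.consEquiv fun _ => E).symm fun s =>
          μ ((Fin.consEquiv fun _ => B).symm b, s) ((Fin.consEquiv fun _ => B).symm b', s)
      have r2 : partialTraceL (μ.submatrix f f) = (partialTraceL μ).submatrix
          (Fin.consEquiv fun _ => E).symm (Fin.consEquiv fun _ => E).symm := by
        ext s s'
        exact Equiv.sum_comp (Fin.consEquiv fun _ => B).symm fun b =>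
          μ (b, (Fin.consEquiv fun _ => E).symm s) (b, (Fin.consEquiv fun _ => E).symm s')
      rw [hW, condEnt, r1, r2, ent_submatrix, ent_submatrix, ent_submatrix, Fin.sum_univ_succ,
        Fin.sum_univ_succ]
      simp only [Fin.cons_zero, Fin.cons_succ]
      rw [condEnt] at c1
      constructor <;> linarith

end Isometry

/-! ### The one-shot converse -/

section OneShot

variable {A B E R : Type*} [Fintype A] [DecidableEq A] [Fintype B] [DecidableEq B]
  [Fintype E] [DecidableEq E] [Fintype R] [DecidableEq R]

open Kronecker

/-- Mutual information, in nats, of a channel given by its Stinespring isometry. -/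
noncomputable def mutualInfo (V : Matrix (B × E) A ℂ) (ρ : Matrix A A ℂ) : ℝ :=
  ent (partialTraceR (V * ρ * Vᴴ)) + condEnt (V * ρ * Vᴴ)

/-- Output of the channel with Stinespring isometry `V`, acting on half of a bipartite state. -/
noncomputable def assistedOut (V : Matrix (B × E) A ℂ) (ω : Matrix (A × R) (A × R) ℂ) :
    Matrix (B × R) (B × R) ℂ :=
  outerMarginal ((V ⊗ₖ (1 : Matrix R R ℂ)) * ω * (V ⊗ₖ (1 : Matrix R R ℂ))ᴴ)

lemma posSemidef_outerMarginal {τ : Matrix ((B × E) × R) ((B × E) × R) ℂ} (hτ : τ.PosSemidef) :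
    (outerMarginal τ).PosSemidef := by
  have : outerMarginal τ = ∑ e, τ.submatrix (fun p : B × R => ((p.1, e), p.2))
      (fun p => ((p.1, e), p.2)) := by
    ext p q
    simp [outerMarginal, Matrix.sum_apply]
  rw [this]
  exact Matrix.posSemidef_sum _ fun x _ => hτ.submatrix _

lemma partialTraceL_outerMarginal (τ : Matrix ((B × E) × R) ((B × E) × R) ℂ) :
    partialTraceL (outerMarginal τ) = partialTraceL τ := by
  ext r r'
  simp only [partialTraceL, outerMarginal, Matrix.of_apply, Fintype.sum_prod_type]

lemma partialTraceR_outerMarginal (τ : Matrix ((B × E) × R) ((B × E) × R) ℂ) :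
    partialTraceR (outerMarginal τ) = partialTraceR (partialTraceR τ) := by
  ext b b'
  simp only [partialTraceR, outerMarginal, Matrix.of_apply]
  rw [Finset.sum_comm]

lemma one_isometry : (1 : Matrix R R ℂ)ᴴ * 1 = 1 := by
  rw [Matrix.conjTranspose_one, Matrix.one_mul]

lemma partialTraceL_assistedOut {V : Matrix (B × E) A ℂ} (hV : Vᴴ * V = 1)
    (ω : Matrix (A × R) (A × R) ℂ) : partialTraceL (assistedOut V ω) = partialTraceL ω := by
  rw [assistedOut, partialTraceL_outerMarginal, partialTraceL_conj_kronecker _ hV]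
  simp

lemma partialTraceR_assistedOut (V : Matrix (B × E) A ℂ) (ω : Matrix (A × R) (A × R) ℂ) :
    partialTraceR (assistedOut V ω) = partialTraceR (V * partialTraceR ω * Vᴴ) := by
  rw [assistedOut, partialTraceR_outerMarginal, partialTraceR_conj_kronecker _ one_isometry]

lemma IsDensity.assistedOut {V : Matrix (B × E) A ℂ} (hV : Vᴴ * V = 1)
    {ω : Matrix (A × R) (A × R) ℂ} (hω : IsDensity ω) : IsDensity (assistedOut V ω) :=
  ⟨posSemidef_outerMarginal (hω.1.mul_mul_conjTranspose_same _), by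
    rw [← trace_partialTraceL, partialTraceL_assistedOut hV, trace_partialTraceL, hω.2]⟩

lemma assistedOut_sum_smul {α : Type*} [Fintype α] (V : Matrix (B × E) A ℂ) (c : ℝ)
    (ω : α → Matrix (A × R) (A × R) ℂ) :
    assistedOut V (∑ a, c • ω a) = ∑ a, c • assistedOut V (ω a) := by
  ext p q
  simp only [assistedOut, outerMarginal, Matrix.mul_sum, Matrix.sum_mul, Matrix.mul_smul,
    Matrix.smul_mul, Matrix.of_apply, Matrix.sum_apply, Matrix.smul_apply, Finset.smul_sum]
  rw [Finset.sum_comm]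

lemma partialTraceR_sum {α : Type*} [Fintype α] (c : ℝ) (ω : α → Matrix (A × R) (A × R) ℂ) :
    partialTraceR (∑ a, c • ω a) = ∑ a, c • partialTraceR (ω a) := by
  ext p q
  simp only [partialTraceR, Matrix.of_apply, Matrix.sum_apply, Matrix.smul_apply,
    Finset.smul_sum]
  rw [Finset.sum_comm]

lemma ent_marginal_sub_le {V : Matrix (B × E) A ℂ} (hV : Vᴴ * V = 1)
    {ω : Matrix (A × R) (A × R) ℂ} (hω : IsDensity ω) :
    ent (partialTraceL ω) - ent (assistedOut V ω) ≤ condEnt (V * partialTraceR ω * Vᴴ) := by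
  have h := ent_add_ent_le
    (hω.1.mul_mul_conjTranspose_same (V ⊗ₖ (1 : Matrix R R ℂ)))
  rw [partialTraceL_conj_kronecker _ hV, partialTraceR_conj_kronecker _ one_isometry,
    Matrix.one_mul, Matrix.conjTranspose_one, Matrix.mul_one] at h
  rw [assistedOut, condEnt]
  linarith

lemma sum_inv_card {M : ℕ} (hM : 1 ≤ M) : ∑ _α : Fin M, (M : ℝ)⁻¹ = 1 := by
  have : (M : ℝ) ≠ 0 := by positivity
  simp [this]

/-- One-shot converse for entanglement-assisted communication. -/
lemma one_shot_converse {V : Matrix (B × E) A ℂ} (hV : Vᴴ * V = 1) {M : ℕ} (hM : 1 ≤ M)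
    {ω : Fin M → Matrix (A × R) (A × R) ℂ} (hω : ∀ α, IsDensity (ω α))
    {β : Matrix R R ℂ} (hβ : ∀ α, partialTraceL (ω α) = β)
    {F : Fin M → Matrix (B × R) (B × R) ℂ} (hF : ∀ α, (F α).PosSemidef)
    (hF1 : (1 - ∑ α, F α).PosSemidef) :
    ((M : ℝ)⁻¹ * ∑ α, (F α * assistedOut V (ω α)).trace.re) * Real.log M - 1 ≤
      ent (partialTraceR (V * (∑ α, (M : ℝ)⁻¹ • partialTraceR (ω α)) * Vᴴ)) +
        (M : ℝ)⁻¹ * ∑ α, condEnt (V * partialTraceR (ω α) * Vᴴ) := by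
  have hc0 : 0 ≤ (M : ℝ)⁻¹ := by positivity
  have h1 := holevo_bound hM (fun α => (hω α).assistedOut hV) hF hF1
  have hd := IsDensity.sum_smul (fun _ => hc0) (sum_inv_card hM) hω
  have h2 := ent_le_add (hd.assistedOut hV)
  have hβ' : partialTraceL (∑ α, (M : ℝ)⁻¹ • ω α) = β := by
    rw [partialTraceL_sum]
    simp only [hβ]
    rw [← Finset.sum_smul, sum_inv_card hM, one_smul]
  rw [partialTraceL_assistedOut hV, partialTraceR_assistedOut, partialTraceR_sum,
    assistedOut_sum_smul, hβ'] at h2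
  have h3 := Finset.sum_le_sum fun α (_ : α ∈ Finset.univ) => ent_marginal_sub_le hV (hω α)
  simp only [hβ, Finset.sum_sub_distrib] at h3
  have h4 := mul_le_mul_of_nonneg_left h3 hc0
  have h5 : (M : ℝ)⁻¹ * ∑ _α : Fin M, ent β = ent β := by
    rw [Finset.mul_sum, ← Finset.sum_mul, sum_inv_card hM, one_mul]
  rw [mul_sub, h5] at h4
  linarith

lemma ent_out_concave {V : Matrix (B × E) A ℂ} (hV : Vᴴ * V = 1) {α : Type*} [Fintype α]
    {c : α → ℝ} (hc : ∀ a, 0 ≤ c a) (hc1 : ∑ a, c a = 1) {ρ : α → Matrix A A ℂ}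
    (hρ : ∀ a, IsDensity (ρ a)) :
    ∑ a, c a * ent (partialTraceR (V * ρ a * Vᴴ)) ≤
      ent (partialTraceR (V * (∑ a, c a • ρ a) * Vᴴ)) := by
  have h := ent_concave hc hc1 fun a => ((hρ a).conj_isometry hV).partialTraceR
  refine h.trans_eq (congrArg ent ?_)
  ext p q
  simp only [partialTraceR, Matrix.mul_sum, Matrix.sum_mul, Matrix.mul_smul,
    Matrix.smul_mul, Matrix.of_apply, Matrix.sum_apply, Matrix.smul_apply, Finset.smul_sum]
  rw [Finset.sum_comm]

lemma condEnt_out_concave (V : Matrix (B × E) A ℂ) {α : Type*} [Fintype α]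
    {c : α → ℝ} (hc : ∀ a, 0 ≤ c a) {ρ : α → Matrix A A ℂ} (hρ : ∀ a, (ρ a).PosSemidef) :
    ∑ a, c a * condEnt (V * ρ a * Vᴴ) ≤ condEnt (V * (∑ a, c a • ρ a) * Vᴴ) := by
  have h := condEnt_concave hc fun a => (hρ a).mul_mul_conjTranspose_same V
  simpa only [Matrix.mul_sum, Matrix.sum_mul, Matrix.mul_smul, Matrix.smul_mul] using h

/-- Converse for a tensor power of a channel: the success probability is bounded through the
mutual information of a single-site state which does not depend on the channel. -/
lemma exists_state_converse {N : ℕ} (hN : 1 ≤ N) {M : ℕ} (hM : 1 ≤ M)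
    {ω : Fin M → Matrix ((Fin N → A) × R) ((Fin N → A) × R) ℂ} (hω : ∀ α, IsDensity (ω α))
    {β : Matrix R R ℂ} (hβ : ∀ α, partialTraceL (ω α) = β)
    {F : Fin M → Matrix ((Fin N → B) × R) ((Fin N → B) × R) ℂ} (hF : ∀ α, (F α).PosSemidef)
    (hF1 : (1 - ∑ α, F α).PosSemidef) :
    ∃ ρ : Matrix A A ℂ, IsDensity ρ ∧ ∀ V : Matrix (B × E) A ℂ, Vᴴ * V = 1 →
      ((M : ℝ)⁻¹ * ∑ α, (F α * assistedOut (powIso N V) (ω α)).trace.re) * Real.log M - 1 ≤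
        N * mutualInfo V ρ := by
  obtain ⟨T, hTl, hTd, hT⟩ := exists_sites (A := A) (B := B) (E := E) N
  have hM0 : 0 ≤ (M : ℝ)⁻¹ := by positivity
  have hN0 : 0 ≤ (N : ℝ)⁻¹ := by positivity
  have hNN : (N : ℝ) * (N : ℝ)⁻¹ = 1 := mul_inv_cancel₀ (by positivity)
  set ρbar := ∑ α, (M : ℝ)⁻¹ • partialTraceR (ω α) with hρbar
  have hρbard : IsDensity ρbar :=
    IsDensity.sum_smul (fun _ => hM0) (sum_inv_card hM) fun α => (hω α).partialTraceR
  have hTbar : ∀ j, T j ρbar = ∑ α, (M : ℝ)⁻¹ • T j (partialTraceR (ω α)) := fun j => by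
    have := map_sum (IsLinearMap.mk' (T j) (hTl j))
      (fun α => (M : ℝ)⁻¹ • partialTraceR (ω α)) Finset.univ
    simpa only [IsLinearMap.mk'_apply, (hTl j).map_smul] using this
  refine ⟨∑ j, (N : ℝ)⁻¹ • T j ρbar, IsDensity.sum_smul (fun _ => hN0) (sum_inv_card hN)
    fun j => hTd j _ hρbard, fun V hV => ?_⟩
  refine (one_shot_converse (powIso_isometry hV N) hM hω hβ hF hF1).trans ?_
  have e1 := (hT V hV _ hρbard).1
  have e2 := ent_out_concave hV (fun _ => hN0) (sum_inv_card hN) fun j => hTd j _ hρbard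
  have e3 := fun α => (hT V hV _ (hω α).partialTraceR).2
  have e4 := fun j => condEnt_out_concave V (fun _ : Fin M => hM0)
    fun α => (hTd j _ (hω α).partialTraceR).1
  have e5 := condEnt_out_concave V (fun _ => hN0) fun j => (hTd j _ hρbard).1
  simp only [← hTbar] at e4
  have e6 : (M : ℝ)⁻¹ * ∑ α, condEnt (powIso N V * partialTraceR (ω α) * (powIso N V)ᴴ) ≤
      ∑ j, condEnt (V * T j ρbar * Vᴴ) := by
    refine (mul_le_mul_of_nonneg_left (Finset.sum_le_sum fun α _ => e3 α) hM0).trans ?_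
    rw [Finset.sum_comm, Finset.mul_sum]
    refine Finset.sum_le_sum fun j _ => ?_
    rw [Finset.mul_sum]
    exact e4 j
  have e7 : ∀ x : Fin N → ℝ, ∑ j, x j = N * ∑ j, (N : ℝ)⁻¹ * x j := fun x => by
    rw [← Finset.mul_sum, ← mul_assoc, hNN, one_mul]
  rw [mutualInfo, mul_add]
  refine add_le_add (e1.trans ?_) (e6.trans ?_)
  · rw [e7]
    exact mul_le_mul_of_nonneg_left e2 (Nat.cast_nonneg N)
  · rw [e7]
    exact mul_le_mul_of_nonneg_left e5 (Nat.cast_nonneg N)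

lemma mutualInfo_nonneg {V : Matrix (B × E) A ℂ} (hV : Vᴴ * V = 1) {ρ : Matrix A A ℂ}
    (hρ : IsDensity ρ) : 0 ≤ mutualInfo V ρ := by
  let e : A × Unit ≃ A := Equiv.prodUnique A Unit
  have hω : IsDensity (ρ.submatrix e e) :=
    ⟨hρ.1.submatrix e, (Equiv.sum_comp e fun x => ρ x x).trans hρ.2⟩
  have h := ent_marginal_sub_le hV hω
  have h1 : partialTraceR (ρ.submatrix e e) = ρ := by
    ext a a'
    simp [partialTraceR, e]
  have h2 := ent_le_add (hω.assistedOut hV)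
  rw [partialTraceR_assistedOut, partialTraceL_assistedOut hV, h1,
    ent_of_unique hω.partialTraceL] at h2
  rw [h1, ent_of_unique hω.partialTraceL] at h
  rw [mutualInfo]
  linarith

lemma mutualInfo_le {V : Matrix (B × E) A ℂ} (hV : Vᴴ * V = 1) {ρ : Matrix A A ℂ}
    (hρ : IsDensity ρ) : mutualInfo V ρ ≤ Fintype.card B + Fintype.card A := by
  have hd := hρ.conj_isometry hV
  have h1 := ent_le_card hd.partialTraceR.1
  have h2 := ent_nonneg hd.partialTraceL
  have h3 : ent (V * ρ * Vᴴ) = ent ρ := by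
    rw [ent_mul_comm, ← Matrix.mul_assoc, hV, Matrix.one_mul]
  have h4 := ent_le_card hρ.1
  rw [mutualInfo, condEnt, h3]
  linarith

end OneShot

section Kraus

variable {dI dO S : ℕ}

/-- The Stinespring isometry of a Kraus family. -/
def stinespring (K : Fin S → Matrix (Fin dO) (Fin dI) ℂ) :
    Matrix (Fin dO × Fin S) (Fin dI) ℂ :=
  Matrix.of fun p a => K p.2 p.1 a

lemma stinespring_isometry {K : Fin S → Matrix (Fin dO) (Fin dI) ℂ} (hK : IsKraus K) :
    (stinespring K)ᴴ * stinespring K = 1 := by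
  rw [← hK]
  ext a a'
  simp only [stinespring, Matrix.mul_apply, Matrix.conjTranspose_apply, Matrix.of_apply,
    Fintype.sum_prod_type, Matrix.sum_apply]
  rw [Finset.sum_comm]

lemma stinespring_conj_apply (K : Fin S → Matrix (Fin dO) (Fin dI) ℂ)
    (ρ : Matrix (Fin dI) (Fin dI) ℂ) (b b' : Fin dO) (s s' : Fin S) :
    (stinespring K * ρ * (stinespring K)ᴴ) (b, s) (b', s') = (K s * ρ * (K s')ᴴ) b b' := by
  simp only [stinespring, Matrix.mul_apply, Matrix.conjTranspose_apply, Matrix.of_apply]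

lemma krausApply_eq (K : Fin S → Matrix (Fin dO) (Fin dI) ℂ) (ρ : Matrix (Fin dI) (Fin dI) ℂ) :
    krausApply K ρ = partialTraceR (stinespring K * ρ * (stinespring K)ᴴ) := by
  ext b b'
  simp only [krausApply, partialTraceR, Matrix.of_apply, Matrix.sum_apply,
    stinespring_conj_apply]

lemma matFun_sqrt {ρ : Matrix (Fin dI) (Fin dI) ℂ} (hρ : ρ.PosSemidef) :
    matFun Real.sqrt ρ * (matFun Real.sqrt ρ)ᴴ = ρ := by
  have hs := hρ.1.spectral_theorem
  rw [Unitary.conjStarAlgAut_apply] at hs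
  have hU : star (hρ.1.eigenvectorUnitary : Matrix (Fin dI) (Fin dI) ℂ) *
    (hρ.1.eigenvectorUnitary : Matrix (Fin dI) (Fin dI) ℂ) = 1 :=
    Matrix.mem_unitaryGroup_iff'.mp hρ.1.eigenvectorUnitary.2
  rw [matFun, dif_pos hρ.1]
  set U := (hρ.1.eigenvectorUnitary : Matrix (Fin dI) (Fin dI) ℂ)
  set D := Matrix.diagonal fun i => ((Real.sqrt (hρ.1.eigenvalues i) : ℝ) : ℂ) with hD
  have hDD : D * Dᴴ = Matrix.diagonal (RCLike.ofReal ∘ hρ.1.eigenvalues) := by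
    rw [hD, Matrix.diagonal_conjTranspose, Matrix.diagonal_mul_diagonal]
    congr 1
    ext i
    simp only [Pi.star_apply, RCLike.star_def, Complex.conj_ofReal]
    rw [← Complex.ofReal_mul, Real.mul_self_sqrt (hρ.eigenvalues_nonneg i)]
    rfl
  calc U * D * star U * (U * D * star U)ᴴ = U * D * (star U * U) * Dᴴ * star U := by
        simp only [Matrix.conjTranspose_mul, Matrix.star_eq_conjTranspose,
          Matrix.conjTranspose_conjTranspose, Matrix.mul_assoc]
    _ = ρ := by
        rw [hU, Matrix.mul_one, Matrix.mul_assoc U, hDD]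
        exact hs.symm

open Kronecker in
lemma ent_krausApplyExt_canonPurif (K : Fin S → Matrix (Fin dO) (Fin dI) ℂ)
    {ρ : Matrix (Fin dI) (Fin dI) ℂ} (hρ : ρ.PosSemidef) :
    (krausApplyExt K (canonPurif ρ)).IsHermitian ∧ ent (krausApplyExt K (canonPurif ρ)) =
      ent (partialTraceL (stinespring K * ρ * (stinespring K)ᴴ)) := by
  set X := matFun Real.sqrt ρ with hX
  have hXX : X * Xᴴ = ρ := matFun_sqrt hρ
  let N : Matrix (Fin dO × Fin dI) (Fin S) ℂ := Matrix.of fun p s => (K s * X) p.1 p.2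
  have hN : krausApplyExt K (canonPurif ρ) = N * Nᴴ := by
    have hv : ∀ s, (K s ⊗ₖ (1 : Matrix (Fin dI) (Fin dI) ℂ)) *ᵥ (fun p => X p.1 p.2)
        = fun p => N p s := by
      intro s
      ext ⟨b, r⟩
      simp [Matrix.mulVec, dotProduct, Fintype.sum_prod_type, Matrix.one_apply, N,
        Matrix.mul_apply]
    ext p q
    rw [krausApplyExt, canonPurif, Matrix.sum_apply, Matrix.mul_apply]
    refine Finset.sum_congr rfl fun s _ => ?_
    rw [← hX, Matrix.mul_vecMulVec, Matrix.vecMulVec_mul, hv, ← Matrix.star_mulVec]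
    rw [hv]
    simp [Matrix.vecMulVec_apply]
  rw [hN]
  refine ⟨Matrix.isHermitian_mul_conjTranspose_self N, ?_⟩
  rw [ent_mul_comm, ← ent_transpose]
  congr 1
  ext s s'
  have h : K s * ρ * (K s')ᴴ = (K s * X) * (K s' * X)ᴴ := by
    rw [← hXX, Matrix.conjTranspose_mul]
    simp only [Matrix.mul_assoc]
  simp only [partialTraceL, Matrix.of_apply, stinespring_conj_apply, h]
  simp only [Matrix.transpose_apply, Matrix.mul_apply (M := Nᴴ), Matrix.conjTranspose_apply, N,
    Matrix.of_apply, Fintype.sum_prod_type]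
  refine Finset.sum_congr rfl fun b _ => ?_
  rw [Matrix.mul_apply]
  exact Finset.sum_congr rfl fun r _ => mul_comm _ _

lemma qmi_eq {K : Fin S → Matrix (Fin dO) (Fin dI) ℂ} (hK : IsKraus K)
    {ρ : Matrix (Fin dI) (Fin dI) ℂ} (hρ : IsDensity ρ) :
    qmi K ρ = mutualInfo (stinespring K) ρ / Real.log 2 := by
  have hV := stinespring_isometry hK
  have hd := hρ.conj_isometry hV
  obtain ⟨h1, h2⟩ := ent_krausApplyExt_canonPurif K hρ.1
  have h3 : ent (stinespring K * ρ * (stinespring K)ᴴ) = ent ρ := by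
    rw [ent_mul_comm, ← Matrix.mul_assoc, hV, Matrix.one_mul]
  rw [qmi, vnEntropy_eq_ent hρ.1.1, krausApply_eq, vnEntropy_eq_ent hd.partialTraceR.1.1,
    vnEntropy_eq_ent h1, h2, mutualInfo, condEnt, h3]
  ring

end Kraus

/-! ### Block codes -/

section Block

variable {d dB m n : ℕ}

/-- Collecting the channel inputs and the ancillas of `n` blocks of length `m`. -/
def blockEquiv (d dB m n : ℕ) :
    (Fin n → (Fin m → Fin d) × (Fin m → Fin dB)) ≃
      (Fin (n * m) → Fin d) × (Fin n → Fin m → Fin dB) where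
  toFun f := (fun j => (f (finProdFinEquiv.symm j).1).1 (finProdFinEquiv.symm j).2,
    fun k => (f k).2)
  invFun p k := (fun l => p.1 (finProdFinEquiv (k, l)), p.2 k)
  left_inv f := by
    ext k : 1
    simp
  right_inv p := by
    refine Prod.ext ?_ rfl
    ext j : 1
    simp [-finProdFinEquiv_symm_apply]

/-- Collecting `n` blocks of length `m`. -/
def arrowEquiv (d m n : ℕ) : (Fin n → Fin m → Fin d) ≃ (Fin (n * m) → Fin d) where
  toFun f := fun j => f (finProdFinEquiv.symm j).1 (finProdFinEquiv.symm j).2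
  invFun p k l := p (finProdFinEquiv (k, l))
  left_inv f := by
    ext k l
    simp
  right_inv p := by
    ext j : 1
    simp [-finProdFinEquiv_symm_apply]

variable {dH dK S Mbr : ℕ}

open Kronecker in
lemma assistedOut_eq_sum {A B E R : Type*} [Fintype A] [DecidableEq A] [Fintype B]
    [DecidableEq B] [Fintype E] [DecidableEq E] [Fintype R] [DecidableEq R]
    (V : Matrix (B × E) A ℂ) (ω : Matrix (A × R) (A × R) ℂ) :
    assistedOut V ω = ∑ e, (V ⊗ₖ (1 : Matrix R R ℂ)).submatrix (fun p : B × R => ((p.1, e), p.2)) id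
      * ω * ((V ⊗ₖ (1 : Matrix R R ℂ)).submatrix (fun p : B × R => ((p.1, e), p.2)) id)ᴴ := by
  ext p q
  rw [Matrix.sum_apply]
  rfl

open Kronecker in
lemma bigKraus_eq (Kr : Fin Mbr → Fin S → Matrix (Fin dK) (Fin dH) ℂ) (i : Fin Mbr)
    (s : Fin n → Fin m → Fin S) :
    bigKraus dB m n Kr i s = (((powIso (n * m) (stinespring (Kr i))) ⊗ₖ
      (1 : Matrix (Fin n → Fin m → Fin dB) (Fin n → Fin m → Fin dB) ℂ)).submatrix
        (fun p : (Fin (n * m) → Fin dK) × (Fin n → Fin m → Fin dB) =>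
          ((p.1, arrowEquiv S m n s), p.2)) id).submatrix
      (blockEquiv dK dB m n) (blockEquiv dH dB m n) := by
  ext f g
  simp only [bigKraus, Matrix.of_apply, Matrix.submatrix_apply, Matrix.kroneckerMap_apply,
    Finset.prod_mul_distrib, id]
  congr 1
  · rw [← Fintype.prod_prod_type' (fun k l => Kr i (s k l) ((f k).1 l) ((g k).1 l)),
      ← Equiv.prod_comp finProdFinEquiv.symm]
    rfl
  · rw [Matrix.one_apply]
    by_cases h : (fun k => (f k).2) = fun k => (g k).2
    · exact (Finset.prod_eq_one fun k _ =>
        (Matrix.one_apply).trans (if_pos (congrFun h k))).trans (if_pos h).symm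
    · obtain ⟨k, hk⟩ := Function.ne_iff.mp h
      exact (Finset.prod_eq_zero (Finset.mem_univ k)
        (if_neg hk)).trans (if_neg h).symm

lemma sum_bigKraus (Kr : Fin Mbr → Fin S → Matrix (Fin dK) (Fin dH) ℂ) (i : Fin Mbr)
    (ρ : Matrix (Fin n → BlkIn dH dB m) (Fin n → BlkIn dH dB m) ℂ) :
    ∑ s, bigKraus dB m n Kr i s * ρ * (bigKraus dB m n Kr i s)ᴴ =
      (assistedOut (powIso (n * m) (stinespring (Kr i)))
        (ρ.submatrix (blockEquiv dH dB m n).symm (blockEquiv dH dB m n).symm)).submatrix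
          (blockEquiv dK dB m n) (blockEquiv dK dB m n) := by
  rw [assistedOut_eq_sum, ← Equiv.sum_comp (arrowEquiv S m n)]
  ext f g
  rw [Matrix.submatrix_apply, Matrix.sum_apply, Matrix.sum_apply]
  refine Finset.sum_congr rfl fun s _ => ?_
  rw [bigKraus_eq, Matrix.conjTranspose_submatrix]
  have : ρ = (ρ.submatrix (blockEquiv dH dB m n).symm (blockEquiv dH dB m n).symm).submatrix
      (blockEquiv dH dB m n) (blockEquiv dH dB m n) := by simp
  conv_lhs => rw [this]
  rw [Matrix.submatrix_mul_equiv, Matrix.submatrix_mul_equiv, Matrix.submatrix_apply]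

lemma posSemidef_prod {ι : Type*} [Fintype ι] [DecidableEq ι] {M : Fin n → Matrix ι ι ℂ}
    (hM : ∀ k, (M k).PosSemidef) :
    (Matrix.of fun f g : Fin n → ι => ∏ k, M k (f k) (g k)).PosSemidef := by
  choose G hG using fun k => exists_gram (hM k)
  have : (Matrix.of fun f g : Fin n → ι => ∏ k, M k (f k) (g k)) =
      (Matrix.of fun f c : Fin n → ι => ∏ k, G k (f k) (c k)) *
        (Matrix.of fun f c : Fin n → ι => ∏ k, G k (f k) (c k))ᴴ := by
    ext f g
    simp only [Matrix.of_apply, Matrix.mul_apply, Matrix.conjTranspose_apply, star_prod,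
      ← Finset.prod_mul_distrib]
    rw [← Fintype.piFinset_univ, ← Finset.prod_univ_sum (fun _ => Finset.univ)
      fun k c => G k (f k) c * star (G k (g k) c)]
    refine Finset.prod_congr rfl fun k _ => ?_
    conv_lhs => rw [hG k]
    rw [Matrix.mul_apply]
    rfl
  rw [this]
  exact Matrix.posSemidef_self_mul_conjTranspose _

lemma IsPureState.isDensity {ι : Type*} [Fintype ι] [DecidableEq ι] {ψ : Matrix ι ι ℂ}
    (hψ : IsPureState ψ) : IsDensity ψ := by
  obtain ⟨v, hv, rfl⟩ := hψ
  refine ⟨Matrix.posSemidef_vecMulVec_self_star v, ?_⟩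
  rw [Matrix.trace]
  simp only [Matrix.diag_apply, Matrix.vecMulVec_apply, Pi.star_apply, RCLike.star_def,
    Complex.mul_conj]
  exact_mod_cast hv

section CPTP

variable {ι κ r : Type*} [Fintype ι] [DecidableEq ι] [Fintype κ] [DecidableEq κ] [Fintype r]
  [DecidableEq r]

lemma IsCPTP.posSemidef_tensorExt {φ : Matrix ι ι ℂ →ₗ[ℂ] Matrix κ κ ℂ} (hφ : IsCPTP φ)
    {M : Matrix (ι × r) (ι × r) ℂ} (hM : M.PosSemidef) : (tensorExt φ M).PosSemidef := by
  let e := Fintype.equivFin r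
  have h := hφ.2 _ (M.submatrix (Prod.map id e.symm) (Prod.map id e.symm)) (hM.submatrix _)
  have h' := h.submatrix (Prod.map (id : κ → κ) e)
  have : tensorExt φ M = (tensorExt φ (M.submatrix (Prod.map id e.symm)
      (Prod.map id e.symm))).submatrix (Prod.map (id : κ → κ) e) (Prod.map id e) := by
    ext p q
    simp [tensorExt]
  rwa [this]

lemma IsCPTP.partialTraceL_tensorExt {φ : Matrix ι ι ℂ →ₗ[ℂ] Matrix κ κ ℂ} (hφ : IsCPTP φ)
    (M : Matrix (ι × r) (ι × r) ℂ) : partialTraceL (tensorExt φ M) = partialTraceL M := by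
  ext y y'
  exact hφ.1 (Matrix.of fun i j => M (i, y) (j, y'))

end CPTP

/-- Bob's share of `n` copies of the entangled state. -/
def bobState (n : ℕ) (Ψ : Matrix (BlkIn dH dB m) (BlkIn dH dB m) ℂ) :
    Matrix (Fin n → Fin m → Fin dB) (Fin n → Fin m → Fin dB) ℂ :=
  Matrix.of fun f g => ∏ k, partialTraceL Ψ (f k) (g k)

lemma trace_prod {ι : Type*} [Fintype ι] (M : Fin n → Matrix ι ι ℂ) :
    (Matrix.of fun f g : Fin n → ι => ∏ k, M k (f k) (g k)).trace = ∏ k, (M k).trace := by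
  classical
  rw [Matrix.trace, ← Fintype.piFinset_univ]
  exact (Finset.prod_univ_sum (fun _ => Finset.univ) fun k c => M k c c).symm

variable {Msz : ℕ}
  {E : Fin Msz → Fin n → (Matrix (Fin m → Fin dH) (Fin m → Fin dH) ℂ →ₗ[ℂ]
    Matrix (Fin m → Fin dH) (Fin m → Fin dH) ℂ)}
  {Ψ : Matrix (BlkIn dH dB m) (BlkIn dH dB m) ℂ}

lemma partialTraceL_codeword (hE : ∀ α k, IsCPTP (E α k)) (α : Fin Msz) :
    partialTraceL ((codeword E Ψ α).submatrix (blockEquiv dH dB m n).symm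
      (blockEquiv dH dB m n).symm) = bobState n Ψ := by
  ext r r'
  simp only [partialTraceL, Matrix.of_apply, Matrix.submatrix_apply, codeword, bobState]
  rw [← Equiv.sum_comp (arrowEquiv dH m n)]
  have h : ∀ k, ∑ x, Ψ (x, r k) (x, r' k) =
      ∑ x, tensorExt (E α k) Ψ (x, r k) (x, r' k) := fun k =>
    (congrFun (congrFun ((hE α k).partialTraceL_tensorExt Ψ) (r k)) (r' k)).symm
  simp only [h]
  rw [Finset.prod_univ_sum, Fintype.piFinset_univ]
  refine Finset.sum_congr rfl fun x _ => Finset.prod_congr rfl fun k _ => ?_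
  simp [blockEquiv, arrowEquiv, -finProdFinEquiv_symm_apply]

lemma isDensity_codeword (hE : ∀ α k, IsCPTP (E α k)) (hΨ : IsDensity Ψ) (α : Fin Msz) :
    IsDensity ((codeword E Ψ α).submatrix (blockEquiv dH dB m n).symm
      (blockEquiv dH dB m n).symm) := by
  refine ⟨(posSemidef_prod fun k => (hE α k).posSemidef_tensorExt hΨ.1).submatrix _, ?_⟩
  rw [← trace_partialTraceL, partialTraceL_codeword hE]
  refine (trace_prod fun _ => partialTraceL Ψ).trans ?_
  simp [trace_partialTraceL, hΨ.2]

lemma trace_mul_submatrix {ι κ : Type*} [Fintype ι] [Fintype κ] (e : ι ≃ κ) (A : Matrix ι ι ℂ)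
    (B : Matrix κ κ ℂ) :
    (A * B.submatrix e e).trace = (A.submatrix e.symm e.symm * B).trace := by
  rw [Matrix.trace, ← Equiv.sum_comp e.symm]
  refine Finset.sum_congr rfl fun x _ => ?_
  simp only [Matrix.diag_apply, Matrix.mul_apply, Matrix.submatrix_apply]
  rw [← Equiv.sum_comp e.symm]
  simp

/-- The weak converse at finite block length. -/
lemma finite_converse {Kr : Fin Mbr → Fin S → Matrix (Fin dK) (Fin dH) ℂ}
    (hKr : ∀ i, IsKraus (Kr i)) {γ : Fin Mbr → ℝ} (hγ1 : ∑ i, γ i = 1)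
    {g : ℝ} (hg : 0 < g) (hgγ : ∀ i, g ≤ γ i) {b : ℝ}
    (hb : ∀ ρ : Matrix (Fin dH) (Fin dH) ℂ, IsDensity ρ → ∃ i, qmi (Kr i) ρ ≤ b)
    (hN : 1 ≤ n * m) (hM : 1 ≤ Msz) (hΨ : IsDensity Ψ) (hE : ∀ α k, IsCPTP (E α k))
    {F : Fin Msz → Matrix (Fin n → BlkOut dK dB m) (Fin n → BlkOut dK dB m) ℂ}
    (hF : ∀ α, (F α).PosSemidef) (hF1 : (1 - ∑ α, F α).PosSemidef) :
    (1 - codeError dB m n Msz Kr γ Ψ E F / g) * Real.logb 2 Msz ≤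
      1 / Real.log 2 + n * m * b := by
  let ω : Fin Msz → Matrix ((Fin (n * m) → Fin dH) × (Fin n → Fin m → Fin dB))
      ((Fin (n * m) → Fin dH) × (Fin n → Fin m → Fin dB)) ℂ := fun α =>
    (codeword E Ψ α).submatrix (blockEquiv dH dB m n).symm (blockEquiv dH dB m n).symm
  let F' : Fin Msz → Matrix ((Fin (n * m) → Fin dK) × (Fin n → Fin m → Fin dB))
      ((Fin (n * m) → Fin dK) × (Fin n → Fin m → Fin dB)) ℂ := fun α =>
    (F α).submatrix (blockEquiv dK dB m n).symm (blockEquiv dK dB m n).symm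
  have hω : ∀ α, IsDensity (ω α) := isDensity_codeword hE hΨ
  have hF' : ∀ α, (F' α).PosSemidef := fun α => (hF α).submatrix _
  have hF1' : (1 - ∑ α, F' α).PosSemidef := by
    have h := hF1.submatrix (blockEquiv dK dB m n).symm
    have e : (1 - ∑ α, F α).submatrix (blockEquiv dK dB m n).symm (blockEquiv dK dB m n).symm
        = 1 - ∑ α, F' α := by
      ext p q
      simp [F', Matrix.sum_apply, Matrix.one_apply]
    rwa [e] at h
  obtain ⟨ρ, hρ, key⟩ := exists_state_converse (E := Fin S) hN hM hω
    (partialTraceL_codeword hE) hF' hF1'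
  obtain ⟨i, hi⟩ := hb ρ hρ
  have hV := fun i => stinespring_isometry (hKr i)
  set P : Fin Mbr → ℝ := fun i => (Msz : ℝ)⁻¹ *
    ∑ α, (F' α * assistedOut (powIso (n * m) (stinespring (Kr i))) (ω α)).trace.re with hP
  have hP1 : ∀ i, P i ≤ 1 := fun i => by
    have h : ∀ α, (F' α * assistedOut (powIso (n * m) (stinespring (Kr i))) (ω α)).trace.re
        ≤ 1 := fun α => by
      have hd := (hω α).assistedOut (powIso_isometry (hV i) (n * m))
      have h0 := (Complex.nonneg_iff.mp
        (trace_mul_nonneg_of_posSemidef (posSemidef_one_sub hF' hF1' α) hd.1)).1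
      rw [Matrix.sub_mul, Matrix.one_mul, Matrix.trace_sub, hd.2, Complex.sub_re,
        Complex.one_re] at h0
      linarith
    have hc : (0 : ℝ) ≤ (Msz : ℝ)⁻¹ := by positivity
    have h2 := mul_le_mul_of_nonneg_left
      (Finset.sum_le_sum fun α (_ : α ∈ Finset.univ) => h α) hc
    rw [Finset.mul_sum Finset.univ (fun _ => (1 : ℝ))] at h2
    simp only [mul_one, sum_inv_card hM] at h2
    exact h2
  have herr : codeError dB m n Msz Kr γ Ψ E F = ∑ i, γ i * (1 - P i) := by
    have h1 : ∀ α, ((F α * chanOut dB m n Kr γ (codeword E Ψ α)).trace).re =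
        ∑ i, γ i * (F' α * assistedOut (powIso (n * m) (stinespring (Kr i)))
          (ω α)).trace.re := fun α => by
      rw [chanOut, Matrix.mul_sum, Matrix.trace_sum, Complex.re_sum]
      refine Finset.sum_congr rfl fun i _ => ?_
      rw [sum_bigKraus, Matrix.mul_smul, Matrix.trace_smul, trace_mul_submatrix,
        Complex.real_smul, Complex.re_ofReal_mul]
    simp only [mul_sub, mul_one, Finset.sum_sub_distrib, hγ1]
    rw [codeError]
    simp only [h1, hP]
    rw [Finset.sum_comm, Finset.mul_sum]
    congr 1
    refine Finset.sum_congr rfl fun i _ => ?_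
    rw [← Finset.mul_sum]
    ring
  have hi1 : g * (1 - P i) ≤ codeError dB m n Msz Kr γ Ψ E F := by
    rw [herr]
    refine (mul_le_mul_of_nonneg_right (hgγ i) (sub_nonneg.mpr (hP1 i))).trans ?_
    exact Finset.single_le_sum (f := fun i => γ i * (1 - P i))
      (fun j _ => mul_nonneg (hg.le.trans (hgγ j)) (sub_nonneg.mpr (hP1 j))) (Finset.mem_univ i)
  have hi2 : 1 - codeError dB m n Msz Kr γ Ψ E F / g ≤ P i := by
    have := (le_div_iff₀' hg).mpr hi1
    linarith
  have hl2 : 0 < Real.log 2 := Real.log_pos one_lt_two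
  have hlM : 0 ≤ Real.log Msz := Real.log_nonneg (by exact_mod_cast hM)
  have hk := key _ (hV i)
  rw [qmi_eq (hKr i) hρ, div_le_iff₀ hl2] at hi
  have h3 : ((n * m : ℕ) : ℝ) * mutualInfo (stinespring (Kr i)) ρ ≤
      ((n * m : ℕ) : ℝ) * (b * Real.log 2) := mul_le_mul_of_nonneg_left hi (Nat.cast_nonneg _)
  have h4 := mul_le_mul_of_nonneg_right hi2 hlM
  push_cast at h3
  rw [Real.logb, ← mul_div_assoc, div_le_iff₀ hl2, add_mul, div_mul_cancel₀ _ hl2.ne']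
  push_cast at hk
  have hk' : P i * Real.log Msz - 1 ≤ n * m * mutualInfo (stinespring (Kr i)) ρ := hk
  nlinarith

end Block

section Asymptotic

variable {dH dK S Mbr : ℕ}

lemma AchievableRate.le {Kr : Fin Mbr → Fin S → Matrix (Fin dK) (Fin dH) ℂ}
    (hKr : ∀ i, IsKraus (Kr i)) {γ : Fin Mbr → ℝ} (hγ1 : ∑ i, γ i = 1)
    {g : ℝ} (hg : 0 < g) (hgγ : ∀ i, g ≤ γ i) {b : ℝ} (hb0 : 0 ≤ b)
    (hb : ∀ ρ : Matrix (Fin dH) (Fin dH) ℂ, IsDensity ρ → ∃ i, qmi (Kr i) ρ ≤ b)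
    {m dB : ℕ} (hm : 1 ≤ m) {Ψ : Matrix (BlkIn dH dB m) (BlkIn dH dB m) ℂ} (hΨ : IsPureState Ψ)
    {R : ℝ} (h : AchievableRate Kr γ m dB Ψ R) : R ≤ m * b := by
  obtain ⟨Msz, hM, hR, E, F, hE, hF, hF1, herr⟩ := h
  refine hR.trans ?_
  rw [Filter.liminf_eq]
  refine Real.sSup_le (fun a ha => ?_) (by positivity)
  have t1 : Filter.Tendsto
      (fun n => a * (1 - codeError dB m n (Msz n) Kr γ Ψ (E n) (F n) / g)) Filter.atTop
      (nhds (a * (1 - 0 / g))) := ((herr.div_const g).const_sub 1).const_mul a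
  have t2 : Filter.Tendsto (fun n : ℕ => 1 / Real.log 2 / n + m * b) Filter.atTop
      (nhds (0 + m * b)) := (tendsto_const_div_atTop_nhds_zero_nat _).add_const _
  have hle := le_of_tendsto_of_tendsto t1 t2 ?_
  · simpa using hle
  filter_upwards [ha, herr.eventually (gt_mem_nhds hg), Filter.eventually_ge_atTop 1]
    with n h1 h2 h3
  have hn : (0 : ℝ) < n := by exact_mod_cast h3
  have h4 := finite_converse hKr hγ1 hg hgγ hb (Nat.mul_pos h3 hm) (hM n) hΨ.isDensity (hE n)
    (hF n) (hF1 n)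
  have h5 : 0 ≤ 1 - codeError dB m n (Msz n) Kr γ Ψ (E n) (F n) / g := by
    have := (div_lt_one hg).mpr h2
    linarith
  refine (mul_le_mul_of_nonneg_right h1 h5).trans ?_
  rw [div_mul_eq_mul_div, div_le_iff₀ hn, mul_comm, add_mul, div_mul_cancel₀ _ hn.ne']
  linarith

lemma CeaM_le {Kr : Fin Mbr → Fin S → Matrix (Fin dK) (Fin dH) ℂ}
    (hKr : ∀ i, IsKraus (Kr i)) {γ : Fin Mbr → ℝ} (hγ1 : ∑ i, γ i = 1)
    {g : ℝ} (hg : 0 < g) (hgγ : ∀ i, g ≤ γ i) {b : ℝ} (hb0 : 0 ≤ b)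
    (hb : ∀ ρ : Matrix (Fin dH) (Fin dH) ℂ, IsDensity ρ → ∃ i, qmi (Kr i) ρ ≤ b)
    {m : ℕ} (hm : 1 ≤ m) : CeaM Kr γ m ≤ m * b := by
  refine Real.sSup_le ?_ (by positivity)
  rintro R ⟨dB, Ψ, hΨ, hR⟩
  exact hR.le hKr hγ1 hg hgγ hb0 hb hm hΨ

lemma Cea_le {Kr : Fin Mbr → Fin S → Matrix (Fin dK) (Fin dH) ℂ}
    (hKr : ∀ i, IsKraus (Kr i)) {γ : Fin Mbr → ℝ} (hγ1 : ∑ i, γ i = 1)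
    {g : ℝ} (hg : 0 < g) (hgγ : ∀ i, g ≤ γ i) {b : ℝ} (hb0 : 0 ≤ b)
    (hb : ∀ ρ : Matrix (Fin dH) (Fin dH) ℂ, IsDensity ρ → ∃ i, qmi (Kr i) ρ ≤ b) :
    Cea Kr γ ≤ b := by
  rw [Cea, Filter.limsup_eq]
  have hmem : b ∈ {a | ∀ᶠ m : ℕ in Filter.atTop, CeaM Kr γ m / m ≤ a} := by
    filter_upwards [Filter.eventually_ge_atTop 1] with m hm
    have hm' : (0 : ℝ) < m := by exact_mod_cast hm
    rw [div_le_iff₀' hm']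
    exact CeaM_le hKr hγ1 hg hgγ hb0 hb hm
  by_cases hbdd : BddBelow {a | ∀ᶠ m : ℕ in Filter.atTop, CeaM Kr γ m / m ≤ a}
  · exact csInf_le hbdd hmem
  · rw [Real.sInf_of_not_bddBelow hbdd]
    exact hb0

end Asymptotic

/-- **Converse part**: the entanglement-assisted classical capacity of the long-term memory
channel `Φ⁽ⁿ⁾ = Σᵢ γᵢ φᵢ^{⊗n}` is at most `max_ρ minᵢ I(ρ; φᵢ)`. -/
theorem converse_ea_capacity {dH dK S Mbr : ℕ} (hMbr : 0 < Mbr)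
    (Kr : Fin Mbr → Fin S → Matrix (Fin dK) (Fin dH) ℂ) (hKr : ∀ i, IsKraus (Kr i))
    (γ : Fin Mbr → ℝ) (hγ : ∀ i, 0 < γ i) (hγ1 : ∑ i, γ i = 1) :
    Cea Kr γ ≤ sSup {x : ℝ | ∃ ρ : Matrix (Fin dH) (Fin dH) ℂ, IsDensity ρ ∧
      x = Finset.univ.inf' ⟨⟨0, hMbr⟩, Finset.mem_univ _⟩ (fun i => qmi (Kr i) ρ)} := by
  have hne : (Finset.univ : Finset (Fin Mbr)).Nonempty := ⟨⟨0, hMbr⟩, Finset.mem_univ _⟩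
  have hl2 : 0 < Real.log 2 := Real.log_pos one_lt_two
  have hV := fun i => stinespring_isometry (hKr i)
  obtain ⟨i₀, -, hi₀⟩ := Finset.exists_min_image Finset.univ γ hne
  refine Cea_le hKr hγ1 (hγ i₀) (fun i => hi₀ i (Finset.mem_univ i)) ?_ fun ρ hρ => ?_
  · refine Real.sSup_nonneg ?_
    rintro x ⟨ρ, hρ, rfl⟩
    refine Finset.le_inf' _ _ fun i _ => ?_
    rw [qmi_eq (hKr i) hρ]
    exact div_nonneg (mutualInfo_nonneg (hV i) hρ) hl2.le
  · obtain ⟨i, -, hi⟩ := Finset.exists_mem_eq_inf' hne fun i => qmi (Kr i) ρ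
    refine ⟨i, hi ▸ le_csSup ⟨(dK + dH) / Real.log 2, ?_⟩ ⟨ρ, hρ, rfl⟩⟩
    rintro x ⟨σ, hσ, rfl⟩
    refine (Finset.inf'_le _ (Finset.mem_univ i₀)).trans ?_
    rw [qmi_eq (hKr i₀) hσ]
    have := mutualInfo_le (hV i₀) hσ
    rw [Fintype.card_fin, Fintype.card_fin] at this
    exact div_le_div_of_nonneg_right this hl2.le
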